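/- Under the setup of the Main Theorem, for every multi-index α ∈ ℕ₀^{n+1} with |α| ≤ r, after shrinking U there is a constant A'' > 0 such that |∂^α Xᵢ(ξ,x)| ≤ A''·dist(x,Z)^{r+1−|α|} for all (ξ,x) ∈ G with x ∉ Z. -/

import Mathlib

open Classical

/-- The full gradient `∇F(ξ,x) = ((g−f)(x), ∇f(x) + ξ∇(g−f)(x))` of
`F(ξ,x) = f(x) + ξ(g−f)(x)`. -/
noncomputable def gradF {n : ℕ} (f g : EuclideanSpace ℝ (Fin n) → ℝ) (ξ : ℝ)
    (x : EuclideanSpace ℝ (Fin n)) : ℝ × EuclideanSpace ℝ (Fin n) :=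
  (g x - f x, gradient f x + ξ • gradient (fun y => g y - f y) x)

/-- The vector field `X(ξ,x) = ((g−f)(x)/|∇F(ξ,x)|²)·∇F(ξ,x)` for `x ∉ Z`, `0` for `x ∈ Z`. -/
noncomputable def XF {n : ℕ} (f g : EuclideanSpace ℝ (Fin n) → ℝ) (ξ : ℝ)
    (x : EuclideanSpace ℝ (Fin n)) : ℝ × EuclideanSpace ℝ (Fin n) :=
  if gradient f x = 0 then 0 else ((g x - f x) / ‖gradF f g ξ x‖ ^ 2) • gradF f g ξ x

/-- The component `Xᵢ`, `i = 0, …, n`, of the vector field `X`. -/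
noncomputable def XComp {n : ℕ} (f g : EuclideanSpace ℝ (Fin n) → ℝ) (i : Fin (n + 1))
    (p : ℝ × EuclideanSpace ℝ (Fin n)) : ℝ :=
  Fin.cases (XF f g p.1 p.2).1 (fun j => (XF f g p.1 p.2).2 j) i

/-- The standard basis of `ℝ × ℝⁿ` as directions for partial derivatives in `(ξ, x₁, …, xₙ)`. -/
noncomputable def basisP (n : ℕ) : Fin (n + 1) → ℝ × EuclideanSpace ℝ (Fin n) :=
  Fin.cases (1, 0) (fun i => (0, EuclideanSpace.single i 1))

/-- Directional (partial) derivative of `h : ℝ × ℝⁿ → ℝ` in the direction `v`. -/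
noncomputable def pdP {n : ℕ} (v : ℝ × EuclideanSpace ℝ (Fin n))
    (h : ℝ × EuclideanSpace ℝ (Fin n) → ℝ) : ℝ × EuclideanSpace ℝ (Fin n) → ℝ :=
  fun p => fderiv ℝ h p v

/-- The partial derivative `∂^α` in `(ξ, x₁, …, xₙ)` for a multi-index `α : ℕ₀^{n+1}`. -/
noncomputable def mpdP {n : ℕ} (α : Fin (n + 1) → ℕ)
    (h : ℝ × EuclideanSpace ℝ (Fin n) → ℝ) : ℝ × EuclideanSpace ℝ (Fin n) → ℝ :=
  (List.finRange (n + 1)).foldr (fun i k => (pdP (basisP n i))^[α i] k) h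

universe u

theorem loj_length_bound {C V : Type*} [CommRing C] [IsDomain C] [IsNoetherianRing C]
    [Ring.KrullDimLE 1 C] [CommRing V] [IsDomain V] [Algebra C V]
    (hinj : Function.Injective (algebraMap C V))
    (hfrac : ∀ v : V, ∃ d : C, d ≠ 0 ∧ ∃ c : C, algebraMap C V d * v = algebraMap C V c)
    (f : C) (hf : f ≠ 0) (l : ℕ) (w : ℕ → V) (hw : ∀ i, ¬ IsUnit (w i))
    (hprod : ∏ i ∈ Finset.range l, w i = algebraMap C V f) :
    (l : ℕ∞) ≤ Ring.ord C f := by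
  rcases Nat.eq_zero_or_pos l with rfl | hl
  · simp
  have hfV : algebraMap C V f ≠ 0 := by
    rwa [Ne, map_eq_zero_iff _ hinj]
  have hden : ∀ m : ℕ, ∃ d : C, d ≠ 0 ∧ ∀ i ≤ m, ∃ c : C,
      algebraMap C V d * ∏ j ∈ Finset.range i, w j = algebraMap C V c := by
    intro m
    induction m with
    | zero => exact ⟨1, one_ne_zero, fun i hi => ⟨1, by simp [Nat.le_zero.mp hi]⟩⟩
    | succ m ih =>
      obtain ⟨d, hd, h⟩ := ih
      obtain ⟨d', hd', c', hc'⟩ := hfrac (∏ j ∈ Finset.range (m+1), w j)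
      refine ⟨d * d', mul_ne_zero hd hd', fun i hi => ?_⟩
      rcases Nat.lt_or_ge m i with h1 | h1
      · obtain rfl : i = m + 1 := by omega
        exact ⟨d * c', by rw [map_mul, map_mul, mul_assoc, hc']⟩
      · obtain ⟨c, hc⟩ := h i h1
        exact ⟨d' * c, by rw [map_mul, map_mul, mul_comm (algebraMap C V d), mul_assoc, hc]⟩
  obtain ⟨d, hd, hdc⟩ := hden l
  have hdV : algebraMap C V d ≠ 0 := by
    rwa [Ne, map_eq_zero_iff _ hinj]
  set p : ℕ → V := fun j => algebraMap C V f ^ (j / l) * ∏ i ∈ Finset.range (j % l), w i with hp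
  have hwl : ∀ i < l, w i ≠ 0 := by
    intro i hi h0
    apply hfV
    rw [← hprod]
    exact Finset.prod_eq_zero (Finset.mem_range.mpr hi) h0
  have hpne : ∀ j, p j ≠ 0 := by
    intro j
    refine mul_ne_zero (pow_ne_zero _ hfV) (Finset.prod_ne_zero_iff.mpr ?_)
    intro i hi
    exact hwl i ((Finset.mem_range.mp hi).trans (Nat.mod_lt _ hl))
  have hpsucc : ∀ j, p (j+1) = p j * w (j % l) := by
    intro j
    simp only [hp]
    rw [mul_assoc, ← Finset.prod_range_succ]
    have h1 := Nat.mod_lt j hl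
    have h2 := Nat.div_add_mod j l
    rcases Nat.lt_or_ge (j % l + 1) l with h | h
    · have e1 : (j+1) / l = j / l := by
        rw [Nat.div_eq_iff hl]; simp only [add_mul, mul_comm (j / l) l]; omega
      have e2 : (j+1) % l = j % l + 1 := by
        have h3 := Nat.div_add_mod (j+1) l
        rw [e1] at h3; omega
      rw [e1, e2]
    · have e : j % l + 1 = l := by omega
      have e1 : (j+1) / l = j / l + 1 := by
        rw [Nat.div_eq_iff hl]; simp only [add_mul, mul_comm (j / l) l]; omega
      have e2 : (j+1) % l = 0 := by
        have h3 := Nat.div_add_mod (j+1) l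
        rw [e1] at h3; nlinarith
      rw [e1, e2, e, hprod]; simp [pow_succ]
  let J : ℕ → Ideal C := fun j => Ideal.comap (algebraMap C V) (Ideal.span {algebraMap C V d * p j})
  have hJmem : ∀ j c, c ∈ J j ↔ algebraMap C V d * p j ∣ algebraMap C V c := by
    intro j c; simp [J, Ideal.mem_comap, Ideal.mem_span_singleton]
  have hJlt : ∀ j, J (j+1) < J j := by
    intro j
    rw [SetLike.lt_iff_le_and_exists]
    constructor
    · intro c hc
      rw [hJmem] at hc ⊢
      refine dvd_trans ?_ hc
      rw [hpsucc]; exact ⟨w (j % l), by ring⟩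
    · obtain ⟨c, hc⟩ := hdc (j % l) (Nat.mod_lt j hl).le
      have e : algebraMap C V (f ^ (j / l) * c) = algebraMap C V d * p j := by
        rw [map_mul, map_pow, ← hc]; simp only [hp]; ring
      refine ⟨f ^ (j / l) * c, (hJmem _ _).mpr (by rw [e]), fun h => ?_⟩
      rw [hJmem, e, hpsucc, ← mul_assoc] at h
      exact hw _ (isUnit_of_dvd_one ((mul_dvd_mul_iff_left (mul_ne_zero hdV (hpne j))).mp
        (by simpa using h)))
  have hanti : StrictAnti J := strictAnti_nat_of_succ_lt hJlt
  have key : ∀ k : ℕ, ((k * l : ℕ) : ℕ∞) ≤ Ring.ord C (d * f ^ k) := by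
    intro k
    unfold Ring.ord
    rw [Module.length_quotient]
    let s : LTSeries (Submodule C C) := LTSeries.mk (k*l) (fun i => J (k * l - i)) (by
      intro a b hab
      apply hanti
      have := a.2; have := b.2
      have : (a:ℕ) < b := hab
      omega)
    refine (Order.length_le_coheight (p := s) ?_).trans' ?_
    · show Ideal.span {d * f ^ k} ≤ J (k * l - 0)
      rw [Ideal.span_singleton_le_iff_mem, hJmem]
      simp [hp, Nat.mul_div_cancel _ hl]
    · exact le_rfl
  have hfz : f ∈ nonZeroDivisors C := mem_nonZeroDivisors_of_ne_zero hf
  have hdz : d ∈ nonZeroDivisors C := mem_nonZeroDivisors_of_ne_zero hd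
  obtain ⟨a, ha⟩ := ENat.ne_top_iff_exists.mp (Ring.ord_ne_top hfz)
  obtain ⟨b, hb⟩ := ENat.ne_top_iff_exists.mp (Ring.ord_ne_top hdz)
  have h := key (b+1)
  rw [Ring.ord_mul C (pow_mem hfz _), Ring.ord_pow hfz, ← ha, ← hb] at h
  rw [← ha]
  have h' : (b+1) * l ≤ b + (b+1) * a := by
    rw [nsmul_eq_mul] at h
    exact_mod_cast h
  have : l ≤ a := by
    by_contra hc
    push Not at hc
    nlinarith
  exact_mod_cast this

theorem loj_uniformizer {C V : Type*} [CommRing C] [IsDomain C] [IsNoetherianRing C]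
    [Ring.KrullDimLE 1 C] [CommRing V] [IsDomain V] [ValuationRing V] [Algebra C V]
    (hinj : Function.Injective (algebraMap C V))
    (hfrac : ∀ v : V, ∃ d : C, d ≠ 0 ∧ ∃ c : C, algebraMap C V d * v = algebraMap C V c)
    (f : C) (hf : f ≠ 0) (hfu : ¬ IsUnit (algebraMap C V f)) :
    ∃ (t : V) (e : ℕ) (u : V), IsLocalRing.maximalIdeal V = Ideal.span {t} ∧ 1 ≤ e ∧
      IsUnit u ∧ algebraMap C V f = t ^ e * u := by
  have bound : ∀ s : Multiset V, (∀ v ∈ s, ¬ IsUnit v) → s.prod = algebraMap C V f →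
      (s.card : ℕ∞) ≤ Ring.ord C f := by
    intro s hs hp
    induction s using Quotient.inductionOn with
    | h L =>
      refine loj_length_bound hinj hfrac f hf L.length (fun i => L.getD i (algebraMap C V f)) ?_ ?_
      · intro i
        by_cases hi : i < L.length
        · rw [List.getD_eq_getElem _ _ hi]
          exact hs _ (by simp)
        · rw [List.getD_eq_default _ _ (by omega)]; exact hfu
      · rw [← hp]
        simp only [Multiset.quot_mk_to_coe, Multiset.prod_coe]
        rw [Finset.prod_range, ← List.prod_ofFn]
        congr 1
        apply List.ext_getElem <;> simp
  obtain ⟨a, ha⟩ := ENat.ne_top_iff_exists.mp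
    (Ring.ord_ne_top (mem_nonZeroDivisors_of_ne_zero hf))
  classical
  let P : ℕ → Prop := fun l => ∃ s : Multiset V, (∀ v ∈ s, ¬ IsUnit v) ∧
    s.prod = algebraMap C V f ∧ s.card = l
  have hPb : ∀ l, P l → l ≤ a := by
    rintro l ⟨s, h1, h2, rfl⟩
    have := bound s h1 h2
    rw [← ha] at this
    exact_mod_cast this
  have hP1 : P 1 := ⟨{algebraMap C V f}, by simpa using hfu, by simp, by simp⟩
  have hmax := Nat.findGreatest_spec (P := P) (hPb 1 hP1) hP1
  have hmax1 := Nat.le_findGreatest (P := P) (hPb 1 hP1) hP1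
  have hmax2 : ∀ l, P l → l ≤ Nat.findGreatest P a := fun l hl =>
    Nat.le_findGreatest (hPb l hl) hl
  set l := Nat.findGreatest P a
  obtain ⟨s, hs, hsp, hsc⟩ := hmax
  have hgen : ∀ t ∈ s, ∀ v : V, ¬ IsUnit v → t ∣ v := by
    intro t ht v hv
    obtain ⟨s', rfl⟩ := Multiset.exists_cons_of_mem ht
    rcases ValuationRing.dvd_total t v with h | ⟨v', h⟩
    · exact h
    · by_cases hu : IsUnit v'
      · obtain ⟨w, rfl⟩ := hu
        exact ⟨(w⁻¹ : Vˣ), by rw [h, mul_assoc]; simp⟩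
      · exfalso
        have : P (l + 1) := by
          refine ⟨v ::ₘ v' ::ₘ s', ?_, ?_, ?_⟩
          · intro x hx
            simp only [Multiset.mem_cons] at hx
            rcases hx with rfl | rfl | hx
            · exact hv
            · exact hu
            · exact hs x (by simp [hx])
          · rw [← hsp]; simp [h, mul_assoc]
          · simp at hsc; simp [hsc]
        have := hmax2 _ this
        omega
  have hsne : s ≠ 0 := by rintro rfl; simp at hsc; omega
  obtain ⟨t, ht⟩ := Multiset.exists_mem_of_ne_zero hsne
  have htl : ∀ s : Multiset V, (∀ v ∈ s, ¬ IsUnit v) → t ^ s.card ∣ s.prod := by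
    intro s
    induction s using Multiset.induction with
    | empty => simp
    | cons a s ih =>
      intro h
      rw [Multiset.card_cons, Multiset.prod_cons, pow_succ']
      exact mul_dvd_mul (hgen t ht a (h a (by simp))) (ih fun v hv => h v (by simp [hv]))
  obtain ⟨u, hu⟩ := htl s hs
  rw [hsp, hsc] at hu
  refine ⟨t, l, u, ?_, hmax1, ?_, hu⟩
  · ext v
    rw [IsLocalRing.mem_maximalIdeal, mem_nonunits_iff, Ideal.mem_span_singleton]
    refine ⟨hgen t ht v, fun h hv => hs t ht (isUnit_of_dvd_unit h hv)⟩
  · by_contra hc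
    have : P (l+1) := by
      refine ⟨u ::ₘ Multiset.replicate l t, ?_, ?_, by simp⟩
      · intro x hx
        simp only [Multiset.mem_cons, Multiset.mem_replicate] at hx
        rcases hx with rfl | ⟨_, rfl⟩
        · exact hc
        · exact hs _ ht
      · rw [hu]; simp [mul_comm]
    have := hmax2 _ this
    omega

theorem loj_formallySmooth {k κ : Type*} [Field k] [CharZero k] [Field κ] [Algebra k κ] :
    Algebra.FormallySmooth k κ := by
  obtain ⟨s, hs⟩ := exists_isTranscendenceBasis k κ
  have := hs.isAlgebraic_field
  exact .of_algebraicIndependent_of_isSeparable hs.1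

theorem loj_deriv_exists {k κ Q : Type*} [Field k] [CharZero k] [Field κ] [Algebra k κ]
    [CommRing Q] [Algebra k Q] (g : Q →ₐ[k] κ) (hg : Function.Surjective g) (τ : Q)
    (hker : RingHom.ker (g : Q →+* κ) = Ideal.span {τ}) (e : ℕ) (he : 1 ≤ e)
    (hτ : τ ^ (e + 1) = 0) (hτ' : τ ^ e ≠ 0) (u : Q) (hu : g u ≠ 0) :
    ∃ D : Derivation k Q Q, D (τ ^ e * u) ≠ 0 := by
  have hfs : Algebra.FormallySmooth k κ := loj_formallySmooth
  have hnil : IsNilpotent (RingHom.ker (g : Q →+* κ)) := by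
    refine ⟨e + 1, ?_⟩
    rw [hker, Ideal.span_singleton_pow, hτ]; simp
  let s : κ →ₐ[k] Q := Algebra.FormallySmooth.liftOfSurjective (AlgHom.id k κ) g hg hnil
  have hs : ∀ c, g (s c) = c := fun c =>
    Algebra.FormallySmooth.liftOfSurjective_apply (AlgHom.id k κ) g hg hnil c
  have hdec : ∀ q : Q, ∃ q', q = s (g q) + τ * q' := by
    intro q
    have : q - s (g q) ∈ RingHom.ker (g : Q →+* κ) := by
      simp [RingHom.mem_ker, hs]
    rw [hker, Ideal.mem_span_singleton] at this
    obtain ⟨c, hc⟩ := this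
    exact ⟨c, by rw [← hc]; ring⟩
  let θ : Polynomial κ →ₐ[k] Q :=
    { Polynomial.eval₂RingHom (s : κ →+* Q) τ with
      commutes' := by
        intro r
        have : (algebraMap k (Polynomial κ)) r = Polynomial.C (algebraMap k κ r) := rfl
        simp [this] }
  have hθC : ∀ c, θ (Polynomial.C c) = s c := fun c => by
    change Polynomial.eval₂ (s : κ →+* Q) τ (Polynomial.C c) = s c
    simp
  have hθX : θ Polynomial.X = τ := by
    change Polynomial.eval₂ (s : κ →+* Q) τ Polynomial.X = τ
    simp
  have hsurj : Function.Surjective θ := by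
    have key : ∀ m : ℕ, ∀ q : Q, ∃ p q', q = θ p + τ ^ m * q' := by
      intro m
      induction m with
      | zero => intro q; exact ⟨0, q, by simp⟩
      | succ m ih =>
        intro q
        obtain ⟨p, q', h⟩ := ih q
        obtain ⟨q'', h'⟩ := hdec q'
        refine ⟨p + Polynomial.X ^ m * Polynomial.C (g q'), q'', ?_⟩
        rw [map_add, map_mul, map_pow, hθC, hθX]
        conv_lhs => rw [h, h']
        ring
    intro q
    obtain ⟨p, q', h⟩ := key (e + 1) q
    exact ⟨p, by rw [h, hτ]; simp⟩
  have hτn : IsNilpotent τ := ⟨e + 1, hτ⟩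
  have hdvd : ∀ p, θ p = 0 → Polynomial.X ^ (e + 1) ∣ p := by
    intro p hp
    have : ∀ d ≤ e + 1, Polynomial.X ^ d ∣ p := by
      intro d
      induction d with
      | zero => intro _; simp
      | succ d ih =>
        intro hd
        obtain ⟨p1, rfl⟩ := ih (by omega)
        rw [pow_succ]
        refine mul_dvd_mul_left _ ?_
        rw [Polynomial.X_dvd_iff]
        by_contra hc
        rw [map_mul, map_pow, hθX] at hp
        have h1 : θ p1 = s (p1.coeff 0) + τ * θ p1.divX := by
          conv_lhs => rw [← Polynomial.X_mul_divX_add p1]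
          rw [map_add, map_mul, hθC, hθX, add_comm]
        have hU : IsUnit (θ p1) := by
          rw [h1, add_comm]
          exact IsNilpotent.isUnit_add_right_of_commute
            (r := τ * θ p1.divX) ((Commute.all _ _).isNilpotent_mul_right hτn)
            ((IsUnit.mk0 _ hc).map s) (Commute.all _ _)
        have h0 : τ ^ d = 0 := (hU.mul_left_eq_zero).1 hp
        apply hτ'
        obtain ⟨j, rfl⟩ : ∃ j, e = d + j := ⟨e - d, by omega⟩
        rw [pow_add, h0, zero_mul]
    exact this _ le_rfl
  let d : Derivation k (Polynomial κ) (Polynomial κ) :=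
    (Polynomial.X : Polynomial κ) • (Polynomial.derivative' : Derivation κ (Polynomial κ) (Polynomial κ)).restrictScalars k
  have hdap : ∀ p, d p = Polynomial.X * Polynomial.derivative p := fun p => rfl
  have hd : ∀ p, θ p = 0 → θ (d p) = 0 := by
    intro p hp
    obtain ⟨p1, rfl⟩ := hdvd p hp
    rw [hdap, Polynomial.derivative_mul, Polynomial.derivative_X_pow]
    simp only [map_mul, map_add, map_pow, hθX, hτ, Nat.add_sub_cancel]
    have : τ * (θ (Polynomial.C ((e + 1 : ℕ) : κ)) * τ ^ e * θ p1 + 0 * θ (Polynomial.derivative p1))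
      = θ (Polynomial.C ((e + 1 : ℕ) : κ)) * τ ^ (e+1) * θ p1 := by ring
    rw [this, hτ]; simp
  refine ⟨Derivation.liftOfSurjective hsurj hd, ?_⟩
  obtain ⟨u', hu'⟩ := hdec u
  have h1 : τ ^ e * u = θ (Polynomial.X ^ e * Polynomial.C (g u)) := by
    rw [map_mul, map_pow, hθC, hθX]
    conv_lhs => rw [hu']
    have : τ ^ e * (s (g u) + τ * u') = τ ^ e * s (g u) + τ ^ (e + 1) * u' := by ring
    rw [this, hτ]; simp
  rw [h1, Derivation.liftOfSurjective_apply hsurj hd, hdap, Polynomial.derivative_mul,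
    Polynomial.derivative_X_pow]
  simp only [Polynomial.derivative_C, mul_zero, add_zero, map_mul, map_pow, hθX, hθC]
  have h2 : τ * (s (e : κ) * τ ^ (e - 1) * s (g u)) = (s (e : κ) * s (g u)) * τ ^ e := by
    obtain ⟨j, rfl⟩ : ∃ j, e = j + 1 := ⟨e - 1, by omega⟩
    simp only [Nat.add_sub_cancel]; ring
  rw [h2]
  have : CharZero κ := charZero_of_injective_algebraMap (algebraMap k κ).injective
  have hU : IsUnit (s (e : κ) * s (g u)) := by
    rw [← map_mul]
    refine (IsUnit.mk0 _ (mul_ne_zero ?_ hu)).map s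
    exact_mod_cast (by omega : e ≠ 0)
  intro h
  exact hτ' ((hU.mul_right_eq_zero).1 h)

theorem loj_quot {k : Type*} {V : Type u} [Field k] [CharZero k] [CommRing V] [IsDomain V]
    [IsLocalRing V] [Algebra k V] (t : V) (e : ℕ) (u : V) (ht : IsLocalRing.maximalIdeal V = Ideal.span {t})
    (he : 1 ≤ e) (ht0 : t ≠ 0) (hu : IsUnit u) :
    ∃ D : Derivation k (V ⧸ Ideal.span {t ^ (e + 1)}) (V ⧸ Ideal.span {t ^ (e + 1)}),
      D (Ideal.Quotient.mk _ (t ^ e * u)) ≠ 0 := by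
  have htm : t ∈ IsLocalRing.maximalIdeal V := by rw [ht]; exact Ideal.mem_span_singleton_self t
  let g : (V ⧸ Ideal.span {t ^ (e + 1)}) →ₐ[k] IsLocalRing.ResidueField V :=
    Ideal.Quotient.liftₐ _ (IsScalarTower.toAlgHom k V (IsLocalRing.ResidueField V)) (by
      intro a ha
      rw [Ideal.mem_span_singleton] at ha
      obtain ⟨b, rfl⟩ := ha
      change IsLocalRing.residue V _ = 0
      rw [IsLocalRing.residue_eq_zero_iff]
      exact Ideal.mul_mem_right _ _ (Ideal.pow_mem_of_mem _ htm _ (by omega)))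
  have hgmk : ∀ v, g (Ideal.Quotient.mk _ v) = IsLocalRing.residue V v := fun v => rfl
  have hg : Function.Surjective g := by
    intro c
    obtain ⟨v, rfl⟩ := IsLocalRing.residue_surjective c
    exact ⟨_, hgmk v⟩
  have hker : RingHom.ker (g : (V ⧸ Ideal.span {t ^ (e + 1)}) →+* IsLocalRing.ResidueField V)
      = Ideal.span {Ideal.Quotient.mk _ t} := by
    ext q
    obtain ⟨v, rfl⟩ := Ideal.Quotient.mk_surjective q
    rw [RingHom.mem_ker, Ideal.mem_span_singleton]
    change g _ = 0 ↔ _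
    rw [hgmk, IsLocalRing.residue_eq_zero_iff, ht, Ideal.mem_span_singleton]
    constructor
    · exact fun h => map_dvd _ h
    · rintro ⟨c, hc⟩
      obtain ⟨w, rfl⟩ := Ideal.Quotient.mk_surjective c
      rw [← map_mul, Ideal.Quotient.mk_eq_mk_iff_sub_mem, Ideal.mem_span_singleton] at hc
      obtain ⟨z, hz⟩ := hc
      exact ⟨w + t ^ e * z, by linear_combination hz⟩
  obtain ⟨D, hD⟩ := loj_deriv_exists (k := k) g hg (Ideal.Quotient.mk _ t) hker e he
    (by rw [← map_pow, Ideal.Quotient.eq_zero_iff_mem]; exact Ideal.mem_span_singleton_self _)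
    (by
      rw [← map_pow, Ne, Ideal.Quotient.eq_zero_iff_mem, Ideal.mem_span_singleton, pow_succ]
      rintro ⟨c, hc⟩
      have : t * c = 1 := by
        apply mul_left_cancel₀ (pow_ne_zero e ht0)
        rw [← mul_assoc]; rw [← hc]; simp
      exact (IsLocalRing.mem_maximalIdeal t).1 htm (IsUnit.of_mul_eq_one _ this))
    (Ideal.Quotient.mk _ u) (by
      rw [hgmk]
      exact (hu.map _).ne_zero)
  refine ⟨D, ?_⟩
  rw [map_mul, map_pow]; exact hD

theorem loj_thmA_aux {k : Type*} {B C : Type u} {V : Type u} [Field k] [CharZero k] [CommRing B]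
    [Algebra k B] [CommRing C] [IsDomain C] [IsNoetherianRing C] [Ring.KrullDimLE 1 C]
    [CommRing V] [IsDomain V] [ValuationRing V] [Algebra B C] [Algebra C V]
    (hinjB : Function.Injective (algebraMap B C))
    (hinj : Function.Injective (algebraMap C V))
    (hfrac : ∀ v : V, ∃ d : C, d ≠ 0 ∧ ∃ c : C, algebraMap C V d * v = algebraMap C V c)
    (y f : B) (hy0 : y ≠ 0) (hy : ¬ IsUnit (algebraMap C V (algebraMap B C y)))
    (hf : f ≠ 0) (hyf : y ∣ f) :
    ∃ (Q : Type u) (_ : CommRing Q) (_ : Algebra k Q) (φ : B →ₐ[k] Q) (D : Derivation k Q Q)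
      (N : ℕ), φ y ^ N = 0 ∧ φ (f * y) = 0 ∧ D (φ f) ≠ 0 := by
  have hinj' : Function.Injective ((algebraMap C V).comp (algebraMap B C)) := by
    intro a b h; exact hinjB (hinj h)
  have hf' : algebraMap B C f ≠ 0 := by
    intro h; exact hf (hinjB (by rw [h, map_zero]))
  have hfu : ¬ IsUnit (algebraMap C V (algebraMap B C f)) := by
    intro h
    obtain ⟨c, rfl⟩ := hyf
    rw [map_mul, map_mul] at h
    exact hy (isUnit_of_mul_isUnit_left h)
  obtain ⟨t, e, u, ht, he, hu, hfe⟩ := loj_uniformizer hinj hfrac (algebraMap B C f) hf' hfu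
  let _ : Algebra k V := ((algebraMap C V).comp ((algebraMap B C).comp (algebraMap k B))).toAlgebra
  let ψ : B →ₐ[k] V := { (algebraMap C V).comp (algebraMap B C) with commutes' := fun r => rfl }
  have hψ : ∀ b, ψ b = algebraMap C V (algebraMap B C b) := fun b => rfl
  have ht0 : t ≠ 0 := by
    rintro rfl
    rw [zero_pow (by omega), zero_mul] at hfe
    exact hf' (hinj (by rw [hfe, map_zero]))
  obtain ⟨D, hD⟩ := loj_quot (k := k) t e u ht he ht0 hu
  have hyt : t ∣ ψ y := by
    rw [← Ideal.mem_span_singleton, ← ht, IsLocalRing.mem_maximalIdeal]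
    exact hy
  obtain ⟨c, hc⟩ := hyt
  refine ⟨V ⧸ Ideal.span {t ^ (e + 1)}, inferInstance, inferInstance,
    (Ideal.Quotient.mkₐ k _).comp ψ, D, e + 1, ?_, ?_, ?_⟩
  · rw [← map_pow]
    change Ideal.Quotient.mk _ (ψ (y ^ (e + 1))) = 0
    rw [Ideal.Quotient.eq_zero_iff_mem, Ideal.mem_span_singleton, map_pow, hc, mul_pow]
    exact dvd_mul_right _ _
  · change Ideal.Quotient.mk _ (ψ (f * y)) = 0
    rw [Ideal.Quotient.eq_zero_iff_mem, Ideal.mem_span_singleton, map_mul, hc, hψ f, hfe]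
    exact ⟨u * c, by ring⟩
  · change D (Ideal.Quotient.mk _ (ψ f)) ≠ 0
    rw [hψ f, hfe]; exact hD

theorem loj_thmA_aux2 {k : Type*} {B C K : Type u} [Field k] [CharZero k] [CommRing B]
    [Algebra k B] [CommRing C] [IsDomain C] [IsNoetherianRing C] [Ring.KrullDimLE 1 C]
    [IsLocalRing C] [Field K] [Algebra C K] [IsFractionRing C K] [Algebra B C]
    (hinjB : Function.Injective (algebraMap B C))
    (y f : B) (hy0 : y ≠ 0) (hy : ¬ IsUnit (algebraMap B C y))
    (hf : f ≠ 0) (hyf : y ∣ f) :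
    ∃ (Q : Type u) (_ : CommRing Q) (_ : Algebra k Q) (φ : B →ₐ[k] Q) (D : Derivation k Q Q)
      (N : ℕ), φ y ^ N = 0 ∧ φ (f * y) = 0 ∧ D (φ f) ≠ 0 := by
  obtain ⟨A, h, hloc⟩ := IsLocalRing.exists_factor_valuationRing (algebraMap C K)
  let _ : Algebra C A := ((algebraMap C K).codRestrict A.toSubring h).toAlgebra
  have hal : ∀ c : C, ((algebraMap C A c : A) : K) = algebraMap C K c :=
    fun c => rfl
  have hinj : Function.Injective (algebraMap C A) := by
    intro a b hab
    apply IsFractionRing.injective C K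
    rw [← hal, ← hal, hab]
  refine loj_thmA_aux (k := k) (C := C) (V := A)
    hinjB hinj ?_ y f hy0 ?_ hf hyf
  · intro v
    obtain ⟨c, d, hd⟩ := IsLocalization.exists_mk'_eq (nonZeroDivisors C) (v : K)
    refine ⟨d, nonZeroDivisors.coe_ne_zero d, c, ?_⟩
    apply Subtype.ext
    change algebraMap C K d * v = algebraMap C K c
    rw [← hd, mul_comm]
    exact IsLocalization.mk'_spec _ _ _
  · intro hU
    exact hy (hloc.map_nonunit _ hU)

theorem loj_thmA_aux3 {k : Type*} {B C : Type u} [Field k] [CharZero k] [CommRing B]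
    [Algebra k B] [CommRing C] [IsDomain C] [IsNoetherianRing C] [Ring.KrullDimLE 1 C]
    [IsLocalRing C] [Algebra B C]
    (hinjB : Function.Injective (algebraMap B C))
    (y f : B) (hy0 : y ≠ 0) (hy : ¬ IsUnit (algebraMap B C y))
    (hf : f ≠ 0) (hyf : y ∣ f) :
    ∃ (Q : Type u) (_ : CommRing Q) (_ : Algebra k Q) (φ : B →ₐ[k] Q) (D : Derivation k Q Q)
      (N : ℕ), φ y ^ N = 0 ∧ φ (f * y) = 0 ∧ D (φ f) ≠ 0 :=
  loj_thmA_aux2 (k := k) (C := C) (K := FractionRing C) hinjB y f hy0 hy hf hyf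

theorem loj_thmA {k : Type*} {B : Type u} [Field k] [CharZero k] [CommRing B] [IsDomain B]
    [IsNoetherianRing B] [Algebra k B]
    (y f : B) (hy0 : y ≠ 0) (hyu : ¬ IsUnit y) (hf : f ≠ 0) (hyf : y ∣ f) :
    ∃ (Q : Type u) (_ : CommRing Q) (_ : Algebra k Q) (φ : B →ₐ[k] Q) (D : Derivation k Q Q)
      (N : ℕ), φ y ^ N = 0 ∧ φ (f * y) = 0 ∧ D (φ f) ≠ 0 := by
  have hne : Ideal.span {y} ≠ ⊤ := by rwa [Ne, Ideal.span_singleton_eq_top]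
  obtain ⟨q, hq⟩ := Ideal.nonempty_minimalPrimes hne
  have hqp : q.IsPrime := hq.1.1
  have hqy : y ∈ q := hq.1.2 (Ideal.mem_span_singleton_self y)
  have hht : q.height ≤ 1 := Ideal.height_le_one_of_isPrincipal_of_mem_minimalPrimes _ q hq
  let C := Localization.AtPrime q
  have : IsDomain C := IsLocalization.isDomain_localization q.primeCompl_le_nonZeroDivisors
  have : IsNoetherianRing C := IsLocalization.isNoetherianRing q.primeCompl C inferInstance
  have : Ring.KrullDimLE 1 C := by
    rw [Ring.krullDimLE_iff, IsLocalization.AtPrime.ringKrullDim_eq_height q C]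
    exact_mod_cast hht
  refine loj_thmA_aux3 (k := k) (C := C)
    (IsLocalization.injective C q.primeCompl_le_nonZeroDivisors) y f hy0 ?_ hf hyf
  rw [IsLocalization.AtPrime.isUnit_to_map_iff C q]
  exact fun h => h hqy

/-- Multiplicative size of a multi-index. -/
noncomputable def lojM {n : ℕ} (α : Fin n →₀ ℕ) : ℕ := α.prod fun i a => (Nat.nth Nat.Prime i) ^ a

theorem lojM_zero {n : ℕ} : lojM (0 : Fin n →₀ ℕ) = 1 := by simp [lojM]

theorem lojM_add {n : ℕ} (α β : Fin n →₀ ℕ) : lojM (α + β) = lojM α * lojM β := by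
  unfold lojM
  exact Finsupp.prod_add_index' (by simp) (by intro a b c; exact pow_add _ _ _)

theorem lojM_pos {n : ℕ} (α : Fin n →₀ ℕ) : 0 < lojM α :=
  Finset.prod_pos fun i _ => pow_pos (Nat.prime_nth_prime i).pos _

theorem lojM_single {n : ℕ} (i : Fin n) (a : ℕ) :
    lojM (Finsupp.single i a) = (Nat.nth Nat.Prime i) ^ a := by
  simp [lojM]

theorem lojM_injective {n : ℕ} : Function.Injective (lojM (n := n)) := by
  have hinj : Function.Injective (fun i : Fin n => Nat.nth Nat.Prime i) := fun i j h =>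
    Fin.ext (Nat.nth_injective Nat.infinite_setOfPred_prime h)
  intro α β h
  have key : ∀ γ : Fin n →₀ ℕ, (lojM γ).factorization
      = γ.mapDomain (fun i : Fin n => Nat.nth Nat.Prime i) := by
    intro γ
    have h1 : lojM γ = (γ.mapDomain (fun i : Fin n => Nat.nth Nat.Prime i)).prod (fun p k => p ^ k) := by
      rw [Finsupp.prod_mapDomain_index (by simp) (by intro a b c; exact pow_add _ _ _)]
      rfl
    rw [h1]
    refine Nat.prod_pow_factorization_eq_self ?_
    intro p hp
    have := Finsupp.mapDomain_support hp
    rw [Finset.mem_image] at this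
    obtain ⟨i, -, rfl⟩ := this
    exact Nat.prime_nth_prime _
  have h2 := key α
  rw [h, key β] at h2
  exact (Finsupp.mapDomain_injective hinj h2).symm

theorem lojM_finite {n : ℕ} (b : ℕ) : {α : Fin n →₀ ℕ | lojM α ≤ b}.Finite :=
  Set.Finite.preimage lojM_injective.injOn (Set.finite_Iic b)

open scoped ENNReal

/-- The weight of a multi-index. -/
noncomputable def lojW {n : ℕ} (k : ℕ) (α : Fin n →₀ ℕ) : ℝ≥0∞ := (((lojM α : ℕ) : ℝ≥0∞) ^ k)⁻¹

theorem lojW_zero {n : ℕ} (k : ℕ) : lojW k (0 : Fin n →₀ ℕ) = 1 := by simp [lojW, lojM_zero]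

theorem lojW_add {n : ℕ} (k : ℕ) (α β : Fin n →₀ ℕ) : lojW k (α + β) = lojW k α * lojW k β := by
  unfold lojW
  rw [lojM_add, Nat.cast_mul, mul_pow, ENNReal.mul_inv]
  · right; exact ENNReal.pow_ne_top (ENNReal.natCast_ne_top _)
  · left; exact ENNReal.pow_ne_top (ENNReal.natCast_ne_top _)

theorem lojW_ne_zero {n : ℕ} (k : ℕ) (α : Fin n →₀ ℕ) : lojW k α ≠ 0 := by
  unfold lojW
  rw [Ne, ENNReal.inv_eq_zero]
  exact ENNReal.pow_ne_top (ENNReal.natCast_ne_top _)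

theorem lojW_ne_top {n : ℕ} (k : ℕ) (α : Fin n →₀ ℕ) : lojW k α ≠ ⊤ := by
  unfold lojW
  rw [Ne, ENNReal.inv_eq_top]
  exact pow_ne_zero _ (by exact_mod_cast (lojM_pos α).ne')

theorem lojW_anti {n : ℕ} {k l : ℕ} (h : k ≤ l) (α : Fin n →₀ ℕ) : lojW l α ≤ lojW k α := by
  unfold lojW
  rw [ENNReal.inv_le_inv]
  exact pow_le_pow_right₀ (by exact_mod_cast (lojM_pos α)) h

/-- Weighted norm of a power series. -/
noncomputable def lojN {n : ℕ} (k : ℕ) (F : MvPowerSeries (Fin n) ℝ) : ℝ≥0∞ :=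
  ∑' α, ‖MvPowerSeries.coeff α F‖ₑ * lojW k α

theorem lojN_anti {n : ℕ} {k l : ℕ} (h : k ≤ l) (F : MvPowerSeries (Fin n) ℝ) :
    lojN l F ≤ lojN k F :=
  ENNReal.tsum_le_tsum fun α => mul_le_mul_right (lojW_anti h α) _

theorem lojN_add {n : ℕ} (k : ℕ) (F G : MvPowerSeries (Fin n) ℝ) :
    lojN k (F + G) ≤ lojN k F + lojN k G := by
  unfold lojN
  rw [← ENNReal.tsum_add]
  refine ENNReal.tsum_le_tsum fun α => ?_
  rw [← add_mul, map_add]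
  exact mul_le_mul_left (enorm_add_le _ _) _

theorem lojN_mul {n : ℕ} (k : ℕ) (F G : MvPowerSeries (Fin n) ℝ) :
    lojN k (F * G) ≤ lojN k F * lojN k G := by
  calc lojN k (F * G) ≤ ∑' α, ∑ p ∈ Finset.HasAntidiagonal.antidiagonal α,
        (‖MvPowerSeries.coeff p.1 F‖ₑ * lojW k p.1) * (‖MvPowerSeries.coeff p.2 G‖ₑ * lojW k p.2) := by
        refine ENNReal.tsum_le_tsum fun α => ?_
        rw [MvPowerSeries.coeff_mul]
        calc _ ≤ (∑ p ∈ Finset.HasAntidiagonal.antidiagonal α, ‖MvPowerSeries.coeff p.1 F * MvPowerSeries.coeff p.2 G‖ₑ) * lojW k α :=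
              mul_le_mul_left (enorm_sum_le _ _) _
          _ = _ := by
              rw [Finset.sum_mul]
              refine Finset.sum_congr rfl fun p hp => ?_
              rw [Finset.HasAntidiagonal.mem_antidiagonal] at hp
              rw [← hp, lojW_add, enorm_mul]; ring
    _ = ∑' p : (Fin n →₀ ℕ) × (Fin n →₀ ℕ), (‖MvPowerSeries.coeff p.1 F‖ₑ * lojW k p.1) * (‖MvPowerSeries.coeff p.2 G‖ₑ * lojW k p.2) := by
        rw [← Finset.HasAntidiagonal.sigmaAntidiagonalEquivProd.tsum_eq, ENNReal.tsum_sigma']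
        refine tsum_congr fun α => ?_
        rw [tsum_fintype, ← Finset.sum_coe_sort]
        rfl
    _ = _ := by
        rw [ENNReal.tsum_prod']
        simp_rw [ENNReal.tsum_mul_left]
        rw [ENNReal.tsum_mul_right]
        rfl

theorem lojN_monomial {n : ℕ} (k : ℕ) (α : Fin n →₀ ℕ) (c : ℝ) :
    lojN k (MvPowerSeries.monomial α c) = ‖c‖ₑ * lojW k α := by
  unfold lojN
  rw [tsum_eq_single α]
  · rw [MvPowerSeries.coeff_monomial_same]
  · intro β hβ
    rw [MvPowerSeries.coeff_monomial_ne hβ]; simp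

/-- The ring of convergent power series. -/
noncomputable def lojC (n : ℕ) : Subalgebra ℝ (MvPowerSeries (Fin n) ℝ) where
  carrier := {F | ∃ k, lojN k F ≠ ⊤}
  mul_mem' := by
    rintro F G ⟨k, hk⟩ ⟨l, hl⟩
    refine ⟨max k l, ne_top_of_le_ne_top (ENNReal.mul_ne_top
      (ne_top_of_le_ne_top hk (lojN_anti (le_max_left k l) F))
      (ne_top_of_le_ne_top hl (lojN_anti (le_max_right k l) G))) (lojN_mul _ F G)⟩
  add_mem' := by
    rintro F G ⟨k, hk⟩ ⟨l, hl⟩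
    refine ⟨max k l, ne_top_of_le_ne_top (ENNReal.add_ne_top.2
      ⟨ne_top_of_le_ne_top hk (lojN_anti (le_max_left k l) F),
      ne_top_of_le_ne_top hl (lojN_anti (le_max_right k l) G)⟩) (lojN_add _ F G)⟩
  algebraMap_mem' := by
    intro c
    refine ⟨0, ?_⟩
    change lojN 0 (MvPowerSeries.monomial 0 c) ≠ ⊤
    rw [lojN_monomial]
    exact ENNReal.mul_ne_top enorm_ne_top (lojW_ne_top _ _)

theorem mem_lojC {n : ℕ} {F : MvPowerSeries (Fin n) ℝ} : F ∈ lojC n ↔ ∃ k, lojN k F ≠ ⊤ := Iff.rfl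

theorem monomial_mem_lojC {n : ℕ} (α : Fin n →₀ ℕ) (c : ℝ) :
    MvPowerSeries.monomial α c ∈ lojC n :=
  ⟨0, by rw [lojN_monomial]; exact ENNReal.mul_ne_top enorm_ne_top (lojW_ne_top _ _)⟩

theorem loj_fix {ι R : Type*} [Zero R] (m : ι → ℕ) (Φ : (ι → R) → ι → R)
    (hloc : ∀ G G' : ι → R, ∀ a, (∀ b, m b < m a → G b = G' b) → Φ G a = Φ G' a) :
    ∃ G, ∀ a, G a = Φ G a := by
  let S : ℕ → ι → R := fun j => Φ^[j] (fun _ => 0)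
  have hS : ∀ j, S (j + 1) = Φ (S j) := fun j => Function.iterate_succ_apply' _ _ _
  have hag : ∀ j i a, m a < j → S (j + i) a = S j a := by
    intro j
    induction j with
    | zero => intro i a h; omega
    | succ j ih =>
      intro i a h
      rw [show j + 1 + i = (j + i) + 1 by ring, hS, hS]
      exact hloc _ _ _ fun b hb => ih i b (by omega)
  refine ⟨fun a => S (m a + 1) a, fun a => ?_⟩
  change S (m a + 1) a = _
  rw [hS]
  refine hloc _ _ _ fun b hb => ?_
  obtain ⟨i, hi⟩ : ∃ i, m a = (m b + 1) + i := ⟨m a - (m b + 1), by omega⟩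
  rw [hi]
  exact hag _ _ _ (by omega)

theorem lojN_eventually {n : ℕ} (h : MvPowerSeries (Fin n) ℝ) (hC : h ∈ lojC n) (β : Fin n →₀ ℕ)
    (hβ : ∀ γ, lojM γ ≤ lojM β → MvPowerSeries.coeff γ h = 0) :
    ∀ᶠ k in Filter.atTop, lojN k h ≤ 2⁻¹ * lojW k β := by
  obtain ⟨k0, hk0⟩ := hC
  set m := lojM β with hm
  have hm0 : 0 < m := lojM_pos β
  have h1 : ∀ j, lojN (k0 + j) h ≤ (((m + 1 : ℕ) : ℝ≥0∞) ^ j)⁻¹ * lojN k0 h := by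
    intro j
    unfold lojN
    rw [← ENNReal.tsum_mul_left]
    refine ENNReal.tsum_le_tsum fun γ => ?_
    by_cases hγ : lojM γ ≤ m
    · rw [hβ γ hγ]; simp
    · have : lojW (k0 + j) γ ≤ (((m + 1 : ℕ) : ℝ≥0∞) ^ j)⁻¹ * lojW k0 γ := by
        unfold lojW
        rw [pow_add, ENNReal.mul_inv (Or.inr (ENNReal.pow_ne_top (ENNReal.natCast_ne_top _)))
          (Or.inl (ENNReal.pow_ne_top (ENNReal.natCast_ne_top _))), mul_comm]
        refine mul_le_mul_left ?_ _
        rw [ENNReal.inv_le_inv]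
        exact pow_le_pow_left₀ (by positivity) (by exact_mod_cast Nat.lt_of_not_le hγ) _
      calc _ ≤ ‖MvPowerSeries.coeff γ h‖ₑ * ((((m + 1 : ℕ) : ℝ≥0∞) ^ j)⁻¹ * lojW k0 γ) :=
            mul_le_mul_right this _
        _ = _ := by ring
  have h2 : Filter.Tendsto (fun j : ℕ => ((m : ℝ≥0∞) / ((m + 1 : ℕ) : ℝ≥0∞)) ^ j * lojN k0 h)
      Filter.atTop (nhds 0) := by
    have : Filter.Tendsto (fun j : ℕ => ((m : ℝ≥0∞) / ((m + 1 : ℕ) : ℝ≥0∞)) ^ j)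
        Filter.atTop (nhds 0) := by
      apply ENNReal.tendsto_pow_atTop_nhds_zero_of_lt_one
      rw [ENNReal.div_lt_iff (Or.inl (by simp)) (Or.inl (ENNReal.natCast_ne_top _)), one_mul]
      exact_mod_cast Nat.lt_succ_self m
    simpa using ENNReal.Tendsto.mul_const this (Or.inr hk0)
  have h3 : ∀ᶠ j : ℕ in Filter.atTop,
      ((m : ℝ≥0∞) / ((m + 1 : ℕ) : ℝ≥0∞)) ^ j * lojN k0 h < 2⁻¹ * lojW k0 β :=
    h2.eventually_lt_const (pos_iff_ne_zero.2 (mul_ne_zero (by simp) (lojW_ne_zero _ _)))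
  obtain ⟨j0, hj0⟩ := Filter.eventually_atTop.1 h3
  refine Filter.eventually_atTop.2 ⟨k0 + j0, fun k hk => ?_⟩
  obtain ⟨j, rfl⟩ : ∃ j, k = k0 + j := ⟨k - k0, by omega⟩
  have h4 := hj0 j (by omega)
  have hmj0 : (m : ℝ≥0∞) ^ j ≠ 0 := pow_ne_zero _ (by exact_mod_cast hm0.ne')
  have hmjt : (m : ℝ≥0∞) ^ j ≠ ⊤ := ENNReal.pow_ne_top (ENNReal.natCast_ne_top _)
  calc lojN (k0 + j) h ≤ (((m + 1 : ℕ) : ℝ≥0∞) ^ j)⁻¹ * lojN k0 h := h1 j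
    _ = ((m : ℝ≥0∞) ^ j)⁻¹ * (((m : ℝ≥0∞) / ((m + 1 : ℕ) : ℝ≥0∞)) ^ j * lojN k0 h) := by
        rw [div_eq_mul_inv, mul_pow, ENNReal.inv_pow, ← mul_assoc, ← mul_assoc,
          ENNReal.inv_mul_cancel hmj0 hmjt, one_mul]
    _ ≤ ((m : ℝ≥0∞) ^ j)⁻¹ * (2⁻¹ * lojW k0 β) := mul_le_mul_right h4.le _
    _ = 2⁻¹ * lojW (k0 + j) β := by
        unfold lojW
        rw [pow_add, ENNReal.mul_inv (Or.inr (ENNReal.pow_ne_top (ENNReal.natCast_ne_top _)))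
          (Or.inl (ENNReal.pow_ne_top (ENNReal.natCast_ne_top _)))]
        ring

theorem loj_div_norm {n : ℕ} (T : Finset (Fin n →₀ ℕ))
    (h : (Fin n →₀ ℕ) → MvPowerSeries (Fin n) ℝ)
    (hh : ∀ β ∈ T, ∀ γ, lojM γ ≤ lojM β → MvPowerSeries.coeff γ (h β) = 0) (k : ℕ)
    (hk : ∀ β ∈ T, lojN k (h β) ≤ 2⁻¹ * lojW k β) (F G : MvPowerSeries (Fin n) ℝ)
    (sel : (Fin n →₀ ℕ) → (Fin n →₀ ℕ)) (q : (Fin n →₀ ℕ) → MvPowerSeries (Fin n) ℝ)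
    (hq : ∀ β μ, MvPowerSeries.coeff μ (q β) =
      if sel (μ + β) = β then MvPowerSeries.coeff (μ + β) G else 0)
    (hG : ∀ α, MvPowerSeries.coeff α G =
      MvPowerSeries.coeff α F - ∑ β ∈ T, MvPowerSeries.coeff α (q β * h β)) :
    lojN k G ≤ 2 * lojN k F := by
  have main : ∀ b : ℕ, ∑ α ∈ (lojM_finite (n := n) b).toFinset,
      ‖MvPowerSeries.coeff α G‖ₑ * lojW k α ≤ 2 * lojN k F := by
    intro b
    set A := (lojM_finite (n := n) b).toFinset with hA
    have hmem : ∀ α, α ∈ A ↔ lojM α ≤ b := by intro α; simp [hA]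
    set S := ∑ α ∈ A, ‖MvPowerSeries.coeff α G‖ₑ * lojW k α with hS
    have hSt : S ≠ ⊤ := ENNReal.sum_ne_top.2 fun α _ =>
      ENNReal.mul_ne_top enorm_ne_top (lojW_ne_top _ _)
    have hβ : ∀ β ∈ T, ∑ α ∈ A, ‖MvPowerSeries.coeff α (q β * h β)‖ₑ * lojW k α ≤
        2⁻¹ * ∑ α ∈ A, if sel α = β then ‖MvPowerSeries.coeff α G‖ₑ * lojW k α else 0 := by
      intro β hβT
      let q' : MvPowerSeries (Fin n) ℝ := fun μ => if lojM (μ + β) ≤ b then MvPowerSeries.coeff μ (q β) else 0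
      have hq' : ∀ μ, MvPowerSeries.coeff μ q' = if lojM (μ + β) ≤ b then MvPowerSeries.coeff μ (q β) else 0 :=
        fun μ => rfl
      have e1 : ∀ α ∈ A, MvPowerSeries.coeff α (q β * h β) = MvPowerSeries.coeff α (q' * h β) := by
        intro α hα
        rw [MvPowerSeries.coeff_mul, MvPowerSeries.coeff_mul]
        refine Finset.sum_congr rfl fun p hp => ?_
        rw [Finset.HasAntidiagonal.mem_antidiagonal] at hp
        by_cases hle : lojM p.2 ≤ lojM β
        · rw [hh β hβT _ hle]; simp
        · rw [hq', if_pos]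
          rw [hmem, ← hp, lojM_add] at hα
          rw [lojM_add]
          exact le_trans (Nat.mul_le_mul_left _ (by omega)) hα
      calc ∑ α ∈ A, ‖MvPowerSeries.coeff α (q β * h β)‖ₑ * lojW k α
          = ∑ α ∈ A, ‖MvPowerSeries.coeff α (q' * h β)‖ₑ * lojW k α :=
            Finset.sum_congr rfl fun α hα => by rw [e1 α hα]
        _ ≤ lojN k (q' * h β) := ENNReal.sum_le_tsum _
        _ ≤ lojN k q' * lojN k (h β) := lojN_mul _ _ _
        _ ≤ lojN k q' * (2⁻¹ * lojW k β) := mul_le_mul_right (hk β hβT) _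
        _ = 2⁻¹ * (∑' μ, ‖MvPowerSeries.coeff μ q'‖ₑ * lojW k μ) * lojW k β := by
            unfold lojN; ring
        _ = 2⁻¹ * ∑' μ, (fun α => if α ∈ A then (if sel α = β then
              ‖MvPowerSeries.coeff α G‖ₑ * lojW k α else 0) else 0) (μ + β) := by
            rw [mul_assoc, ← ENNReal.tsum_mul_right]
            congr 1
            refine tsum_congr fun μ => ?_
            simp only [hmem]
            rw [hq', hq]
            split_ifs
            · rw [lojW_add, mul_assoc]
            · simp
            · simp
        _ ≤ 2⁻¹ * ∑' α, (fun α => if α ∈ A then (if sel α = β then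
              ‖MvPowerSeries.coeff α G‖ₑ * lojW k α else 0) else 0) α := by
            refine mul_le_mul_right ?_ _
            exact ENNReal.tsum_comp_le_tsum_of_injective (add_left_injective β) _
        _ = _ := by
            congr 1
            rw [tsum_eq_sum (s := A)]
            · exact Finset.sum_congr rfl fun α hα => by simp only [if_pos hα]
            · intro α hα; simp only [if_neg hα]
    have h1 : S ≤ lojN k F + 2⁻¹ * S := by
      calc S ≤ ∑ α ∈ A, (‖MvPowerSeries.coeff α F‖ₑ * lojW k α +
            ∑ β ∈ T, ‖MvPowerSeries.coeff α (q β * h β)‖ₑ * lojW k α) := by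
            refine Finset.sum_le_sum fun α _ => ?_
            rw [hG α, ← Finset.sum_mul, ← add_mul]
            refine mul_le_mul_left ?_ _
            rw [sub_eq_add_neg]
            refine (enorm_add_le _ _).trans ?_
            rw [enorm_neg]
            exact add_le_add le_rfl (enorm_sum_le _ _)
        _ = ∑ α ∈ A, ‖MvPowerSeries.coeff α F‖ₑ * lojW k α +
            ∑ β ∈ T, ∑ α ∈ A, ‖MvPowerSeries.coeff α (q β * h β)‖ₑ * lojW k α := by
            rw [Finset.sum_add_distrib, Finset.sum_comm (s := A)]
        _ ≤ lojN k F + ∑ β ∈ T, 2⁻¹ * ∑ α ∈ A, (if sel α = β then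
              ‖MvPowerSeries.coeff α G‖ₑ * lojW k α else 0) :=
            add_le_add (ENNReal.sum_le_tsum _) (Finset.sum_le_sum hβ)
        _ ≤ lojN k F + 2⁻¹ * S := by
            refine add_le_add le_rfl ?_
            rw [← Finset.mul_sum, Finset.sum_comm]
            refine mul_le_mul_right ?_ _
            refine Finset.sum_le_sum fun α _ => ?_
            rw [Finset.sum_ite_eq]
            split_ifs
            · exact le_rfl
            · exact zero_le
    have h2 : S = 2⁻¹ * S + 2⁻¹ * S := by
      rw [← add_mul, ENNReal.inv_two_add_inv_two, one_mul]
    have h3 : 2⁻¹ * S ≤ lojN k F := by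
      have hfin : 2⁻¹ * S ≠ ⊤ := ENNReal.mul_ne_top (by simp) hSt
      rw [h2] at h1
      have h1' : 2⁻¹ * S + 2⁻¹ * S ≤ lojN k F + 2⁻¹ * S := by
        rw [← h2] at h1; rw [← h2]; exact h1
      exact (ENNReal.add_le_add_iff_right hfin).1 h1'
    calc S = 2 * (2⁻¹ * S) := by
          rw [← mul_assoc, ENNReal.mul_inv_cancel (by simp) (by simp), one_mul]
      _ ≤ _ := mul_le_mul_right h3 _
  unfold lojN
  rw [ENNReal.tsum_eq_iSup_sum]
  refine iSup_le fun s => ?_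
  refine le_trans ?_ (main (s.sup lojM))
  refine Finset.sum_le_sum_of_subset ?_
  intro α hα
  simp only [Set.Finite.mem_toFinset, Set.mem_setOf_eq]
  exact Finset.le_sup (f := lojM) hα

theorem loj_division {n : ℕ} (T : Finset (Fin n →₀ ℕ))
    (h : (Fin n →₀ ℕ) → MvPowerSeries (Fin n) ℝ)
    (hh : ∀ β ∈ T, ∀ γ, lojM γ ≤ lojM β → MvPowerSeries.coeff γ (h β) = 0) (k : ℕ)
    (hk : ∀ β ∈ T, lojN k (h β) ≤ 2⁻¹ * lojW k β) (F : MvPowerSeries (Fin n) ℝ)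
    (hF : lojN k F ≠ ⊤) :
    ∃ (q : (Fin n →₀ ℕ) → MvPowerSeries (Fin n) ℝ) (r : MvPowerSeries (Fin n) ℝ),
      (∀ β ∈ T, lojN k (q β) ≠ ⊤) ∧
      F = ∑ β ∈ T, q β * (MvPowerSeries.monomial β 1 + h β) + r ∧
      ∀ α, (∃ β ∈ T, β ≤ α) → MvPowerSeries.coeff α r = 0 := by
  have hsel : ∀ α, ∃ s, (∃ β ∈ T, β ≤ α) → s ∈ T ∧ s ≤ α := by
    intro α
    by_cases hα : ∃ β ∈ T, β ≤ α
    · obtain ⟨β, h1, h2⟩ := hα; exact ⟨β, fun _ => ⟨h1, h2⟩⟩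
    · exact ⟨0, fun h => absurd h hα⟩
  choose sel hsel using hsel
  let Q : ((Fin n →₀ ℕ) → ℝ) → (Fin n →₀ ℕ) → MvPowerSeries (Fin n) ℝ := fun G β μ =>
    if sel (μ + β) = β then G (μ + β) else 0
  have hQ : ∀ G β μ, MvPowerSeries.coeff μ (Q G β) = if sel (μ + β) = β then G (μ + β) else 0 :=
    fun _ _ _ => rfl
  obtain ⟨G, hG⟩ := loj_fix (R := ℝ) (lojM (n := n))
    (fun G α => MvPowerSeries.coeff α F - ∑ β ∈ T, MvPowerSeries.coeff α (Q G β * h β)) (by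
      intro G G' α hGG
      congr 1
      refine Finset.sum_congr rfl fun β hβ => ?_
      rw [MvPowerSeries.coeff_mul, MvPowerSeries.coeff_mul]
      refine Finset.sum_congr rfl fun p hp => ?_
      rw [Finset.HasAntidiagonal.mem_antidiagonal] at hp
      by_cases hle : lojM p.2 ≤ lojM β
      · rw [hh β hβ _ hle]; simp
      · rw [hQ, hQ, hGG (p.1 + β)]
        rw [← hp, lojM_add, lojM_add]
        exact Nat.mul_lt_mul_of_pos_left (by omega) (lojM_pos _))
  let G' : MvPowerSeries (Fin n) ℝ := G
  have hG' : ∀ α, MvPowerSeries.coeff α G' = G α := fun _ => rfl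
  have hN : lojN k G' ≤ 2 * lojN k F := by
    refine loj_div_norm T h hh k hk F G' sel (Q G) ?_ ?_
    · intro β μ; rw [hQ, hG']
    · intro α; rw [hG', hG α]
  have hNt : lojN k G' ≠ ⊤ := ne_top_of_le_ne_top (ENNReal.mul_ne_top (by simp) hF) hN
  let r : MvPowerSeries (Fin n) ℝ := fun α => if ∃ β ∈ T, β ≤ α then 0 else G α
  have hr : ∀ α, MvPowerSeries.coeff α r = if ∃ β ∈ T, β ≤ α then 0 else G α := fun _ => rfl
  refine ⟨Q G, r, ?_, ?_, ?_⟩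
  · intro β _
    have : lojN k (Q G β) * lojW k β ≤ lojN k G' := by
      calc lojN k (Q G β) * lojW k β ≤ ∑' μ, (fun α => ‖MvPowerSeries.coeff α G'‖ₑ * lojW k α) (μ + β) := by
            unfold lojN
            rw [← ENNReal.tsum_mul_right]
            refine ENNReal.tsum_le_tsum fun μ => ?_
            rw [hQ]
            change _ ≤ ‖MvPowerSeries.coeff (μ + β) G'‖ₑ * lojW k (μ + β)
            split_ifs
            · rw [lojW_add, ← mul_assoc, hG']
            · simp
        _ ≤ _ := ENNReal.tsum_comp_le_tsum_of_injective (add_left_injective β) _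
    intro htop
    rw [htop, ENNReal.top_mul (lojW_ne_zero _ _)] at this
    exact hNt (top_le_iff.1 this)
  · ext α
    simp only [mul_add, map_add, map_sum, Finset.sum_add_distrib]
    have h1 : ∑ β ∈ T, MvPowerSeries.coeff α (Q G β * MvPowerSeries.monomial β 1) =
        if ∃ β ∈ T, β ≤ α then G α else 0 := by
      have : ∀ β ∈ T, MvPowerSeries.coeff α (Q G β * MvPowerSeries.monomial β 1) =
          if sel α = β then (if ∃ β ∈ T, β ≤ α then G α else 0) else 0 := by
        intro β hβ
        rw [MvPowerSeries.coeff_mul_monomial]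
        by_cases hle : β ≤ α
        · have hex : ∃ β ∈ T, β ≤ α := ⟨β, hβ, hle⟩
          rw [if_pos hle, hQ, tsub_add_cancel_of_le hle, if_pos hex, mul_one]
        · rw [if_neg hle]
          split_ifs with h2 h3
          · exact absurd (h2 ▸ (hsel α h3).2) hle
          · rfl
          · rfl
      rw [Finset.sum_congr rfl this, Finset.sum_ite_eq]
      split_ifs with h1 h2 h2
      · rfl
      · rfl
      · exact absurd (hsel α h2).1 h1
      · rfl
    have h2 := hG α
    rw [h1, hr]
    split_ifs at * <;> linarith
  · intro α hα
    rw [hr, if_pos hα]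

theorem loj_dickson {n : ℕ} (E : Set (Fin n →₀ ℕ)) :
    ∃ T : Finset (Fin n →₀ ℕ), (∀ t ∈ T, t ∈ E) ∧ ∀ β ∈ E, ∃ t ∈ T, t ≤ β := by
  have hfin : {x | Minimal (· ∈ E) x}.Finite :=
    WellQuasiOrderedLE.finite_of_isAntichain (setOfPred_minimal_antichain _)
  refine ⟨hfin.toFinset, ?_, ?_⟩
  · intro t ht
    rw [Set.Finite.mem_toFinset] at ht
    exact ht.1
  · intro β hβ
    obtain ⟨t, ht, ht'⟩ := exists_minimal_le_of_wellFoundedLT (· ∈ E) β hβ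
    exact ⟨t, by rw [Set.Finite.mem_toFinset]; exact ht', ht⟩

instance loj_noeth {n : ℕ} : IsNoetherianRing (lojC n) := by
  rw [isNoetherianRing_iff_ideal_fg]
  intro I
  obtain ⟨T, hTE, hT⟩ := loj_dickson {β : Fin n →₀ ℕ | ∃ g ∈ I, MvPowerSeries.coeff β (g : MvPowerSeries (Fin n) ℝ) = 1 ∧
    ∀ γ, lojM γ < lojM β → MvPowerSeries.coeff γ (g : MvPowerSeries (Fin n) ℝ) = 0}
  have : ∀ β, ∃ g : lojC n, β ∈ T → g ∈ I ∧ MvPowerSeries.coeff β (g : MvPowerSeries (Fin n) ℝ) = 1 ∧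
    ∀ γ, lojM γ < lojM β → MvPowerSeries.coeff γ (g : MvPowerSeries (Fin n) ℝ) = 0 := by
    intro β
    by_cases hβ : β ∈ T
    · obtain ⟨g, hg⟩ := hTE β hβ
      exact ⟨g, fun _ => hg⟩
    · exact ⟨0, fun h => absurd h hβ⟩
  choose g hg using this
  have hle : Ideal.span ((T.image g : Finset (lojC n)) : Set (lojC n)) ≤ I := by
    rw [Ideal.span_le]
    intro x hx
    rw [Finset.coe_image] at hx
    obtain ⟨β, hβ, rfl⟩ := hx
    exact (hg β hβ).1
  refine ⟨T.image g, le_antisymm hle ?_⟩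
  intro F hF
  let h : (Fin n →₀ ℕ) → MvPowerSeries (Fin n) ℝ := fun β => (g β : MvPowerSeries (Fin n) ℝ) - MvPowerSeries.monomial β 1
  have hh : ∀ β ∈ T, ∀ γ, lojM γ ≤ lojM β → MvPowerSeries.coeff γ (h β) = 0 := by
    intro β hβ γ hγ
    change MvPowerSeries.coeff γ (_ - _) = 0
    rw [map_sub]
    rcases eq_or_lt_of_le hγ with he | hl
    · rw [lojM_injective he, (hg β hβ).2.1, MvPowerSeries.coeff_monomial_same, sub_self]
    · rw [(hg β hβ).2.2 γ hl, MvPowerSeries.coeff_monomial_ne, sub_self]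
      rintro rfl; exact lt_irrefl _ hl
  have hev : ∀ᶠ k in Filter.atTop, ∀ β ∈ T, lojN k (h β) ≤ 2⁻¹ * lojW k β := by
    rw [Filter.eventually_all_finset]
    intro β hβ
    exact lojN_eventually (h β) ((lojC n).sub_mem (g β).2 (monomial_mem_lojC β 1)) β (hh β hβ)
  obtain ⟨k0, hk0⟩ := F.2
  obtain ⟨k, hk, hkk⟩ := (hev.and (Filter.eventually_ge_atTop k0)).exists
  obtain ⟨q, r, hq, hFe, hr⟩ := loj_division T h hh k hk F (ne_top_of_le_ne_top hk0 (lojN_anti hkk _))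
  let q' : (Fin n →₀ ℕ) → lojC n := fun β => if hβ : β ∈ T then ⟨q β, k, hq β hβ⟩ else 0
  have hsum : ((∑ β ∈ T, q' β * g β : lojC n) : MvPowerSeries (Fin n) ℝ)
      = ∑ β ∈ T, q β * (MvPowerSeries.monomial β 1 + h β) := by
    rw [AddSubmonoidClass.coe_finsetSum]
    refine Finset.sum_congr rfl fun β hβ => ?_
    have : q' β = ⟨q β, k, hq β hβ⟩ := dif_pos hβ
    rw [MulMemClass.coe_mul, this]
    congr 1
    change _ = MvPowerSeries.monomial β 1 + ((g β : MvPowerSeries (Fin n) ℝ) - MvPowerSeries.monomial β 1)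
    ring
  have hsI : (∑ β ∈ T, q' β * g β : lojC n) ∈ Ideal.span ((T.image g : Finset (lojC n)) : Set (lojC n)) := by
    refine Ideal.sum_mem _ fun β hβ => Ideal.mul_mem_left _ _ (Ideal.subset_span ?_)
    rw [Finset.coe_image]; exact ⟨β, hβ, rfl⟩
  have hr0 : F - ∑ β ∈ T, q' β * g β = 0 := by
    set R := F - ∑ β ∈ T, q' β * g β with hR
    have hRI : R ∈ I := I.sub_mem hF (hle hsI)
    have hRr : (R : MvPowerSeries (Fin n) ℝ) = r := by
      rw [hR, AddSubgroupClass.coe_sub, hsum, hFe]; ring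
    by_contra hne
    have hex : ∃ m, ∃ α, lojM α = m ∧ MvPowerSeries.coeff α (R : MvPowerSeries (Fin n) ℝ) ≠ 0 := by
      by_contra hcon
      push Not at hcon
      apply hne
      apply Subtype.ext
      ext α
      simpa using hcon _ α rfl
    obtain ⟨α, hα, hα0⟩ := Nat.find_spec hex
    have hmin : ∀ γ, lojM γ < lojM α → MvPowerSeries.coeff γ (R : MvPowerSeries (Fin n) ℝ) = 0 := by
      intro γ hγ
      by_contra hc
      exact Nat.find_min hex (hα ▸ hγ) ⟨γ, rfl, hc⟩
    obtain ⟨t, ht, htα⟩ := hT α ⟨(MvPowerSeries.coeff α (R : MvPowerSeries (Fin n) ℝ))⁻¹ • R, by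
      rw [Algebra.smul_def]; exact I.mul_mem_left _ hRI, by
      change MvPowerSeries.coeff α (_ • (R : MvPowerSeries (Fin n) ℝ)) = 1
      rw [map_smul, smul_eq_mul, inv_mul_cancel₀ hα0], by
      intro γ hγ
      change MvPowerSeries.coeff γ (_ • (R : MvPowerSeries (Fin n) ℝ)) = 0
      rw [map_smul, hmin γ hγ, smul_zero]⟩
    exact hα0 (by rw [hRr]; exact hr α ⟨t, ht, htα⟩)
  rw [sub_eq_zero.1 hr0]
  exact hsI

theorem loj_summable {ι : Type*} {a : ι → ℝ} (h : ∑' i, ‖a i‖ₑ ≠ ⊤) : Summable a := by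
  have : Summable fun i => ‖a i‖₊ := ENNReal.tsum_coe_ne_top_iff_summable.1 h
  exact Summable.of_nnnorm this

/-- Monomials. -/
noncomputable def lojmon {n : ℕ} (x : EuclideanSpace ℝ (Fin n)) (α : Fin n →₀ ℕ) : ℝ :=
  α.prod fun i a => x i ^ a

theorem lojmon_add {n : ℕ} (x : EuclideanSpace ℝ (Fin n)) (α β : Fin n →₀ ℕ) :
    lojmon x (α + β) = lojmon x α * lojmon x β :=
  Finsupp.prod_add_index' (by simp) (by intro a b c; exact pow_add _ _ _)

theorem lojmon_zero {n : ℕ} (x : EuclideanSpace ℝ (Fin n)) : lojmon x 0 = 1 := by simp [lojmon]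

theorem lojmon_single {n : ℕ} (x : EuclideanSpace ℝ (Fin n)) (i : Fin n) (a : ℕ) :
    lojmon x (Finsupp.single i a) = x i ^ a := by simp [lojmon]

/-- Polydisc. -/
def lojP {n : ℕ} (k : ℕ) (x : EuclideanSpace ℝ (Fin n)) : Prop :=
  ∀ i, ‖x i‖ₑ ≤ lojW k (Finsupp.single i 1)

theorem lojmon_le {n : ℕ} {k : ℕ} {x : EuclideanSpace ℝ (Fin n)} (hx : lojP k x) (α : Fin n →₀ ℕ) :
    ‖lojmon x α‖ₑ ≤ lojW k α := by
  induction α using Finsupp.induction_linear with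
  | zero => simp [lojmon_zero, lojW_zero]
  | add α β h1 h2 => rw [lojmon_add, lojW_add, enorm_mul]; exact mul_le_mul' h1 h2
  | single i a =>
    induction a with
    | zero => simp [lojmon_zero, lojW_zero]
    | succ a ih =>
      rw [Finsupp.single_add, lojmon_add, lojW_add, enorm_mul]
      refine mul_le_mul' ih ?_
      rw [lojmon_single, pow_one]; exact hx i

theorem lojP_eventually {n : ℕ} (k : ℕ) :
    ∀ᶠ x : EuclideanSpace ℝ (Fin n) in nhds 0, lojP k x := by
  unfold lojP
  rw [Filter.eventually_all]
  intro i
  have : Filter.Tendsto (fun x : EuclideanSpace ℝ (Fin n) => ‖x i‖ₑ) (nhds 0) (nhds 0) := by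
    have : Continuous (fun x : EuclideanSpace ℝ (Fin n) => ‖x i‖ₑ) := by fun_prop
    have h := this.tendsto 0
    simpa using h
  filter_upwards [this.eventually_lt_const (pos_iff_ne_zero.2 (lojW_ne_zero k (Finsupp.single i 1)))] with x hx
  exact hx.le

/-- Evaluation of a convergent series. -/
noncomputable def lojE {n : ℕ} (F : MvPowerSeries (Fin n) ℝ) (x : EuclideanSpace ℝ (Fin n)) : ℝ :=
  ∑' α, MvPowerSeries.coeff α F * lojmon x α

theorem lojE_enorm {n : ℕ} {k : ℕ} {x : EuclideanSpace ℝ (Fin n)} (hx : lojP k x)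
    (F : MvPowerSeries (Fin n) ℝ) :
    ∑' α, ‖MvPowerSeries.coeff α F * lojmon x α‖ₑ ≤ lojN k F := by
  refine ENNReal.tsum_le_tsum fun α => ?_
  rw [enorm_mul]; exact mul_le_mul_right (lojmon_le hx α) _

theorem lojE_summable {n : ℕ} {k : ℕ} {x : EuclideanSpace ℝ (Fin n)} (hx : lojP k x)
    {F : MvPowerSeries (Fin n) ℝ} (hF : lojN k F ≠ ⊤) :
    Summable fun α => MvPowerSeries.coeff α F * lojmon x α :=
  loj_summable (ne_top_of_le_ne_top hF (lojE_enorm hx F))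

theorem lojE_bound {n : ℕ} {k : ℕ} {x : EuclideanSpace ℝ (Fin n)} (hx : lojP k x)
    (F : MvPowerSeries (Fin n) ℝ) : ‖lojE F x‖ₑ ≤ lojN k F :=
  enorm_tsum_le_tsum_enorm.trans (lojE_enorm hx F)

theorem lojC_common {n : ℕ} {F G : MvPowerSeries (Fin n) ℝ} (hF : F ∈ lojC n) (hG : G ∈ lojC n) :
    ∃ k, lojN k F ≠ ⊤ ∧ lojN k G ≠ ⊤ := by
  obtain ⟨k, hk⟩ := hF
  obtain ⟨l, hl⟩ := hG
  exact ⟨max k l, ne_top_of_le_ne_top hk (lojN_anti (le_max_left k l) F),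
      ne_top_of_le_ne_top hl (lojN_anti (le_max_right k l) G)⟩

theorem lojE_add {n : ℕ} {F G : MvPowerSeries (Fin n) ℝ} (hF : F ∈ lojC n) (hG : G ∈ lojC n) :
    ∀ᶠ x in nhds 0, lojE (F + G) x = lojE F x + lojE G x := by
  obtain ⟨k, hk, hl⟩ := lojC_common hF hG
  filter_upwards [lojP_eventually k] with x hx
  unfold lojE
  rw [← (lojE_summable hx hk).tsum_add (lojE_summable hx hl)]
  simp only [map_add, add_mul]

theorem lojE_mul {n : ℕ} {F G : MvPowerSeries (Fin n) ℝ} (hF : F ∈ lojC n) (hG : G ∈ lojC n) :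
    ∀ᶠ x in nhds 0, lojE (F * G) x = lojE F x * lojE G x := by
  obtain ⟨k, hk, hl⟩ := lojC_common hF hG
  filter_upwards [lojP_eventually k] with x hx
  unfold lojE
  have s1 := lojE_summable hx hk
  have s2 := lojE_summable hx hl
  have s3 := summable_mul_of_summable_norm s1.norm s2.norm
  have key := Summable.tsum_mul_tsum_eq_tsum_sum_antidiagonal s1 s2 s3
  refine Eq.trans (tsum_congr fun α => ?_) key.symm
  rw [MvPowerSeries.coeff_mul, Finset.sum_mul]
  refine Finset.sum_congr rfl fun p hp => ?_
  have hp' : p.1 + p.2 = α := Finset.HasAntidiagonal.mem_antidiagonal.1 hp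
  rw [← hp', lojmon_add]; ring

theorem lojE_monomial {n : ℕ} (α : Fin n →₀ ℕ) (c : ℝ) (x : EuclideanSpace ℝ (Fin n)) :
    lojE (MvPowerSeries.monomial α c) x = c * lojmon x α := by
  unfold lojE
  rw [tsum_eq_single α]
  · rw [MvPowerSeries.coeff_monomial_same]
  · intro β hβ
    rw [MvPowerSeries.coeff_monomial_ne hβ]; simp

theorem lojE_bdd {n : ℕ} {F : MvPowerSeries (Fin n) ℝ} (hF : F ∈ lojC n) :
    ∃ M : ℝ, ∀ᶠ x in nhds 0, |lojE F x| ≤ M := by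
  obtain ⟨k, hk⟩ := hF
  refine ⟨(lojN k F).toReal, ?_⟩
  filter_upwards [lojP_eventually k] with x hx
  have := ENNReal.toReal_mono hk (lojE_bound hx F)
  simpa using this

/-- Count of indices. -/
noncomputable def lojcnt {n : ℕ} (i : Σ m : ℕ, (Fin m → Fin n)) : Fin n →₀ ℕ :=
  ∑ j, Finsupp.single (i.2 j) 1

theorem lojW_sum {n : ℕ} (k : ℕ) {ι : Type*} (s : Finset ι) (a : ι → Fin n →₀ ℕ) :
    lojW k (∑ j ∈ s, a j) = ∏ j ∈ s, lojW k (a j) := by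
  induction s using Finset.induction_on with
  | empty => simp [lojW_zero]
  | insert j s hj ih => rw [Finset.sum_insert hj, Finset.prod_insert hj, lojW_add, ih]

theorem lojmon_sum {n : ℕ} (x : EuclideanSpace ℝ (Fin n)) {ι : Type*} (s : Finset ι) (a : ι → Fin n →₀ ℕ) :
    lojmon x (∑ j ∈ s, a j) = ∏ j ∈ s, lojmon x (a j) := by
  induction s using Finset.induction_on with
  | empty => simp [lojmon_zero]
  | insert j s hj ih => rw [Finset.sum_insert hj, Finset.prod_insert hj, lojmon_add, ih]

theorem lojW_single_le {n : ℕ} (k : ℕ) (i : Fin n) :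
    lojW k (Finsupp.single i 1) ≤ ((2 : ℝ≥0∞) ^ k)⁻¹ := by
  unfold lojW
  rw [lojM_single, pow_one, ENNReal.inv_le_inv]
  exact pow_le_pow_left₀ (by positivity) (by exact_mod_cast (Nat.prime_nth_prime i).two_le) _

theorem loj_analytic {n : ℕ} {f : EuclideanSpace ℝ (Fin n) → ℝ} (hf : AnalyticAt ℝ f 0) :
    ∃ F ∈ lojC n, ∀ᶠ x in nhds 0, f x = lojE F x := by
  obtain ⟨p, r, hp⟩ := hf
  have hrad : 0 < p.radius := lt_of_lt_of_le hp.r_pos hp.r_le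
  obtain ⟨ρ, hρ0, hρ⟩ := ENNReal.lt_iff_exists_nnreal_btwn.1 hrad
  have hρs := p.summable_nnnorm_mul_pow hρ
  have hρs' : ∑' m, ‖p m‖ₑ * (ρ : ℝ≥0∞) ^ m ≠ ⊤ := by
    have := ENNReal.tsum_coe_ne_top_iff_summable.2 hρs
    simpa [enorm] using this
  obtain ⟨k, hk⟩ : ∃ k : ℕ, (n : ℝ≥0∞) * ((2 : ℝ≥0∞) ^ k)⁻¹ ≤ ρ := by
    have h1 : Filter.Tendsto (fun k : ℕ => (n : ℝ≥0∞) * ((2 : ℝ≥0∞)⁻¹) ^ k) Filter.atTop (nhds 0) := by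
      have : Filter.Tendsto (fun k : ℕ => ((2 : ℝ≥0∞)⁻¹) ^ k) Filter.atTop (nhds 0) :=
        ENNReal.tendsto_pow_atTop_nhds_zero_of_lt_one (by simp)
      simpa using ENNReal.Tendsto.const_mul (a := (n : ℝ≥0∞)) this (Or.inr (ENNReal.natCast_ne_top n))
    obtain ⟨k, hk⟩ := (h1.eventually_lt_const hρ0).exists
    exact ⟨k, by rw [ENNReal.inv_pow]; exact hk.le⟩
  let c : (Σ m : ℕ, (Fin m → Fin n)) → ℝ := fun i => p i.1 (fun j => EuclideanSpace.single (i.2 j) (1 : ℝ))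
  have hcb : ∀ i, ‖c i‖ₑ ≤ ‖p i.1‖ₑ := by
    intro i
    have : ‖c i‖ ≤ ‖p i.1‖ := by
      refine ((p i.1).le_opNorm _).trans ?_
      simp
    exact enorm_le_iff_norm_le.2 this
  have hWb : ∀ i : (Σ m : ℕ, (Fin m → Fin n)), lojW k (lojcnt i) ≤ (((2 : ℝ≥0∞) ^ k)⁻¹) ^ i.1 := by
    intro i
    unfold lojcnt
    rw [lojW_sum]
    refine (Finset.prod_le_prod' fun j _ => lojW_single_le k (i.2 j)).trans ?_
    simp
  have hfin : ∑' i, ‖c i‖ₑ * lojW k (lojcnt i) ≠ ⊤ := by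
    refine ne_top_of_le_ne_top hρs' ?_
    rw [ENNReal.tsum_sigma']
    refine ENNReal.tsum_le_tsum fun m => ?_
    rw [tsum_fintype]
    calc _ ≤ ∑ s : Fin m → Fin n, ‖p m‖ₑ * (((2 : ℝ≥0∞) ^ k)⁻¹) ^ m :=
          Finset.sum_le_sum fun s _ => mul_le_mul' (hcb ⟨m, s⟩) (hWb ⟨m, s⟩)
      _ = ‖p m‖ₑ * ((n : ℝ≥0∞) * ((2 : ℝ≥0∞) ^ k)⁻¹) ^ m := by
          simp [mul_pow]; ring
      _ ≤ _ := mul_le_mul_right (pow_le_pow_left₀ (by positivity) hk m) _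
  let F : MvPowerSeries (Fin n) ℝ := fun α => ∑' i : {i // lojcnt i = α}, c i
  have hF : ∀ α, MvPowerSeries.coeff α F = ∑' i : {i // lojcnt i = α}, c i := fun _ => rfl
  refine ⟨F, ⟨k, ?_⟩, ?_⟩
  · refine ne_top_of_le_ne_top hfin ?_
    rw [← (Equiv.sigmaFiberEquiv (lojcnt (n := n))).tsum_eq, ENNReal.tsum_sigma']
    refine ENNReal.tsum_le_tsum fun α => ?_
    rw [hF]
    refine (mul_le_mul_left enorm_tsum_le_tsum_enorm _).trans ?_
    rw [← ENNReal.tsum_mul_right]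
    refine ENNReal.tsum_le_tsum fun i => ?_
    obtain ⟨i, rfl⟩ := i
    exact le_rfl
  · filter_upwards [lojP_eventually k, hp.eventually_hasSum] with x hx hsum
    rw [zero_add] at hsum
    let a : (Σ m : ℕ, (Fin m → Fin n)) → ℝ := fun i => c i * lojmon x (lojcnt i)
    have ha : Summable a := by
      refine loj_summable (ne_top_of_le_ne_top hfin (ENNReal.tsum_le_tsum fun i => ?_))
      rw [enorm_mul]; exact mul_le_mul_right (lojmon_le hx _) _
    have h1 : lojE F x = ∑' i, a i := by
      have ha' : Summable (a ∘ (Equiv.sigmaFiberEquiv (lojcnt (n := n)))) :=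
        (Equiv.summable_iff _).2 ha
      rw [← (Equiv.sigmaFiberEquiv (lojcnt (n := n))).tsum_eq]
      have := ha'.tsum_sigma
      refine Eq.trans ?_ this.symm
      unfold lojE
      refine tsum_congr fun α => ?_
      rw [hF, ← tsum_mul_right]
      refine tsum_congr fun i => ?_
      obtain ⟨i, rfl⟩ := i
      rfl
    have h2 : ∑' i, a i = ∑' m, p m (fun _ => x) := by
      rw [ha.tsum_sigma]
      refine tsum_congr fun m => ?_
      rw [tsum_fintype]
      have hxs : x = ∑ i, x i • EuclideanSpace.single i (1 : ℝ) := by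
        ext j
        simp [Finset.sum_apply, Pi.single_apply]
      have h3 : p m (fun _ => x) = p m (fun _ => ∑ i, x i • EuclideanSpace.single i (1 : ℝ)) := by
        rw [← hxs]
      rw [h3, ContinuousMultilinearMap.map_sum]
      refine Finset.sum_congr rfl fun s _ => ?_
      rw [ContinuousMultilinearMap.map_smul_univ]
      change p m _ * lojmon x (lojcnt ⟨m, s⟩) = _
      unfold lojcnt
      rw [lojmon_sum, smul_eq_mul, mul_comm]
      simp [lojmon_single]
    rw [h1, h2]
    exact hsum.tsum_eq.symm

theorem loj_mul_W {n : ℕ} (k : ℕ) (γ : Fin n →₀ ℕ) (i : Fin n) :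
    ((γ i : ℕ) : ℝ≥0∞) * lojW (k + 1) γ ≤ lojW k γ := by
  have h1 : γ i ≤ lojM γ := by
    conv_rhs => rw [← Finsupp.single_add_erase i γ]
    rw [lojM_add, lojM_single]
    calc γ i ≤ 2 ^ (γ i) := Nat.lt_two_pow_self.le
      _ ≤ (Nat.nth Nat.Prime i) ^ (γ i) := Nat.pow_le_pow_left (Nat.prime_nth_prime i).two_le _
      _ ≤ _ := Nat.le_mul_of_pos_right _ (lojM_pos _)
  have h0 : ((lojM γ : ℕ) : ℝ≥0∞) ≠ 0 := by exact_mod_cast (lojM_pos γ).ne'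
  unfold lojW
  rw [pow_succ, ENNReal.mul_inv (Or.inr (ENNReal.natCast_ne_top _))
          (Or.inl (ENNReal.pow_ne_top (ENNReal.natCast_ne_top _)))]
  calc _ ≤ ((lojM γ : ℕ) : ℝ≥0∞) * ((((lojM γ : ℕ) : ℝ≥0∞) ^ k)⁻¹ * ((lojM γ : ℕ) : ℝ≥0∞)⁻¹) :=
        mul_le_mul_left (by exact_mod_cast h1) _
    _ = (((lojM γ : ℕ) : ℝ≥0∞) ^ k)⁻¹ * (((lojM γ : ℕ) : ℝ≥0∞) * ((lojM γ : ℕ) : ℝ≥0∞)⁻¹) := by ring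
    _ = _ := by rw [ENNReal.mul_inv_cancel h0 (ENNReal.natCast_ne_top _), mul_one]

theorem loj_pderiv_term {n : ℕ} (k : ℕ) (γ : Fin n →₀ ℕ) (i : Fin n) :
    ((γ i : ℕ) : ℝ≥0∞) * lojW (k + 1) (γ - Finsupp.single i 1) ≤
      (lojW (k + 1) (Finsupp.single i 1))⁻¹ * lojW k γ := by
  by_cases h : γ i = 0
  · simp [h]
  have hle : Finsupp.single i 1 ≤ γ := by
    rw [Finsupp.single_le_iff]; omega
  have h1 : lojW (k + 1) (γ - Finsupp.single i 1) =
      (lojW (k + 1) (Finsupp.single i 1))⁻¹ * lojW (k + 1) γ := by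
    conv_rhs => rw [← tsub_add_cancel_of_le hle, lojW_add]
    rw [mul_comm (lojW _ _), ← mul_assoc, ENNReal.inv_mul_cancel (lojW_ne_zero _ _) (lojW_ne_top _ _),
      one_mul]
  rw [h1, mul_left_comm]
  exact mul_le_mul_right (loj_mul_W k γ i) _

theorem loj_pderiv_N {n : ℕ} (k : ℕ) (F : MvPowerSeries (Fin n) ℝ) (i : Fin n) :
    lojN (k + 1) (MvPowerSeries.pderiv ℝ i F) ≤ (lojW (k + 1) (Finsupp.single i 1))⁻¹ * lojN k F := by
  calc lojN (k + 1) (MvPowerSeries.pderiv ℝ i F)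
      = ∑' α : Fin n →₀ ℕ, (fun γ : Fin n →₀ ℕ => ‖MvPowerSeries.coeff γ F‖ₑ * (((γ i : ℕ) : ℝ≥0∞) *
          lojW (k + 1) (γ - Finsupp.single i 1))) (α + Finsupp.single i 1) := by
        unfold lojN
        refine tsum_congr fun α => ?_
        dsimp only
        rw [MvPowerSeries.coeff_pderiv, enorm_mul, add_tsub_cancel_right, mul_assoc]
        congr 2
        have : ((α i : ℝ) + 1) = (((α + Finsupp.single i 1 : Fin n →₀ ℕ) i : ℕ) : ℝ) := by simp
        rw [this, Real.enorm_natCast]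
    _ ≤ ∑' γ : Fin n →₀ ℕ, ‖MvPowerSeries.coeff γ F‖ₑ * (((γ i : ℕ) : ℝ≥0∞) *
          lojW (k + 1) (γ - Finsupp.single i 1)) :=
        ENNReal.tsum_comp_le_tsum_of_injective (add_left_injective (Finsupp.single i 1)) _
    _ ≤ ∑' γ : Fin n →₀ ℕ, (lojW (k + 1) (Finsupp.single i 1))⁻¹ * (‖MvPowerSeries.coeff γ F‖ₑ * lojW k γ) := by
        refine ENNReal.tsum_le_tsum fun γ => ?_
        rw [mul_left_comm (lojW (k + 1) (Finsupp.single i 1))⁻¹]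
        exact mul_le_mul_right (loj_pderiv_term k γ i) _
    _ = _ := by rw [ENNReal.tsum_mul_left]; rfl

theorem loj_pderiv_mem {n : ℕ} {F : MvPowerSeries (Fin n) ℝ} (hF : F ∈ lojC n) (i : Fin n) :
    MvPowerSeries.pderiv ℝ i F ∈ lojC n := by
  obtain ⟨k, hk⟩ := hF
  exact ⟨k + 1, ne_top_of_le_ne_top (ENNReal.mul_ne_top (ENNReal.inv_ne_top.2 (lojW_ne_zero _ _)) hk)
    (loj_pderiv_N k F i)⟩

theorem lojmon_erase {n : ℕ} (x : EuclideanSpace ℝ (Fin n)) (γ : Fin n →₀ ℕ) (i : Fin n) :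
    lojmon x γ = x i ^ (γ i) * lojmon x (γ.erase i) := by
  conv_lhs => rw [← Finsupp.single_add_erase i γ]
  rw [lojmon_add, lojmon_single]

theorem lojmon_deriv {n : ℕ} (x : EuclideanSpace ℝ (Fin n)) (γ : Fin n →₀ ℕ) (i : Fin n) (t : ℝ) :
    HasDerivAt (fun t : ℝ => lojmon (x + t • EuclideanSpace.single i (1 : ℝ)) γ)
      ((γ i : ℝ) * lojmon (x + t • EuclideanSpace.single i (1 : ℝ)) (γ - Finsupp.single i 1)) t := by
  have hsame : ∀ t : ℝ, lojmon (x + t • EuclideanSpace.single i (1 : ℝ)) (γ.erase i) = lojmon x (γ.erase i) := by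
    intro t
    unfold lojmon
    refine Finsupp.prod_congr fun j hj => ?_
    have : j ≠ i := by
      rintro rfl; simp at hj
    simp [this]
  have hi : ∀ t : ℝ, (x + t • EuclideanSpace.single i (1 : ℝ)) i = x i + t := by intro t; simp
  have e1 : (fun t : ℝ => lojmon (x + t • EuclideanSpace.single i (1 : ℝ)) γ) =
      fun t => (x i + t) ^ (γ i) * lojmon x (γ.erase i) := by
    funext t
    rw [lojmon_erase _ γ i, hsame, hi]
  have e2 : (γ - Finsupp.single i 1).erase i = γ.erase i := by
    ext j
    by_cases hj : j = i
    · subst hj; simp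
    · simp [Finsupp.erase_ne hj, Finsupp.single_eq_of_ne hj]
  rw [e1, lojmon_erase _ (γ - Finsupp.single i 1) i, e2, hsame, hi]
  have := ((hasDerivAt_id t).const_add (x i)).pow (γ i) |>.mul_const (lojmon x (γ.erase i))
  refine this.congr_deriv ?_
  simp
  ring

theorem lojE_pderiv_eq {n : ℕ} (F : MvPowerSeries (Fin n) ℝ) (i : Fin n) (x : EuclideanSpace ℝ (Fin n)) :
    lojE (MvPowerSeries.pderiv ℝ i F) x =
      ∑' γ : Fin n →₀ ℕ, MvPowerSeries.coeff γ F * ((γ i : ℝ) * lojmon x (γ - Finsupp.single i 1)) := by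
  have hinj : Function.Injective (fun α : Fin n →₀ ℕ => α + Finsupp.single i 1) := add_left_injective _
  rw [← hinj.tsum_eq]
  · unfold lojE
    refine tsum_congr fun α => ?_
    rw [MvPowerSeries.coeff_pderiv, add_tsub_cancel_right]
    simp; ring
  · intro γ hγ
    rw [Function.mem_support] at hγ
    have : γ i ≠ 0 := by rintro h; apply hγ; simp [h]
    have hle : Finsupp.single i 1 ≤ γ := by
      rw [Finsupp.single_le_iff]; omega
    exact ⟨γ - Finsupp.single i 1, tsub_add_cancel_of_le hle⟩

theorem lojE_hasDerivAt {n : ℕ} {F : MvPowerSeries (Fin n) ℝ} (hF : F ∈ lojC n) (i : Fin n) :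
    ∀ᶠ x in nhds 0, HasDerivAt (fun t : ℝ => lojE F (x + t • EuclideanSpace.single i (1 : ℝ)))
      (lojE (MvPowerSeries.pderiv ℝ i F) x) 0 := by
  obtain ⟨k, hk⟩ := hF
  obtain ⟨ε, hε, hball⟩ := Metric.eventually_nhds_iff.1 (lojP_eventually (n := n) (k + 1))
  have hev : ∀ᶠ x : EuclideanSpace ℝ (Fin n) in nhds 0, dist x 0 < ε / 2 := Metric.ball_mem_nhds 0 (by positivity)
  filter_upwards [hev] with x hx
  have hP : ∀ t ∈ Metric.ball (0 : ℝ) (ε / 2), lojP (k + 1) (x + t • EuclideanSpace.single i (1 : ℝ)) := by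
    intro t ht
    apply hball
    rw [dist_zero_right] at hx ⊢
    rw [Metric.mem_ball, dist_zero_right] at ht
    calc ‖x + t • EuclideanSpace.single i (1 : ℝ)‖ ≤ ‖x‖ + ‖t • EuclideanSpace.single i (1 : ℝ)‖ := norm_add_le _ _
      _ = ‖x‖ + ‖t‖ := by rw [norm_smul]; simp
      _ < ε := by linarith
  let c : ℝ≥0∞ := (lojW (k + 1) (Finsupp.single i 1 : Fin n →₀ ℕ))⁻¹
  have hc : c ≠ ⊤ := ENNReal.inv_ne_top.2 (lojW_ne_zero _ _)
  let u : (Fin n →₀ ℕ) → ℝ := fun γ => (c * (‖MvPowerSeries.coeff γ F‖ₑ * lojW k γ)).toReal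
  have hsumE : ∑' γ, c * (‖MvPowerSeries.coeff γ F‖ₑ * lojW k γ) ≠ ⊤ := by
    rw [ENNReal.tsum_mul_left]; exact ENNReal.mul_ne_top hc hk
  have hu : Summable u := ENNReal.summable_toReal hsumE
  have h0 : (0 : ℝ) ∈ Metric.ball (0 : ℝ) (ε / 2) := Metric.mem_ball_self (by positivity)
  have := hasDerivAt_tsum_of_isPreconnected (𝕜 := ℝ) (u := u)
    (g := fun γ (t : ℝ) => MvPowerSeries.coeff γ F * lojmon (x + t • EuclideanSpace.single i (1 : ℝ)) γ)
    (g' := fun γ (t : ℝ) => MvPowerSeries.coeff γ F * ((γ i : ℝ) * lojmon (x + t • EuclideanSpace.single i (1 : ℝ)) (γ - Finsupp.single i 1)))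
    (t := Metric.ball (0 : ℝ) (ε / 2)) (y₀ := 0) (y := 0) hu Metric.isOpen_ball
    (convex_ball _ _).isPreconnected
    (fun γ t _ => (lojmon_deriv x γ i t).const_mul _)
    (by
      intro γ t ht
      have hb : ‖MvPowerSeries.coeff γ F * ((γ i : ℝ) * lojmon (x + t • EuclideanSpace.single i (1 : ℝ)) (γ - Finsupp.single i 1))‖ₑ
          ≤ c * (‖MvPowerSeries.coeff γ F‖ₑ * lojW k γ) := by
        rw [enorm_mul, enorm_mul, mul_left_comm c, Real.enorm_natCast]
        refine mul_le_mul_right ?_ _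
        refine le_trans ?_ (loj_pderiv_term k γ i)
        exact mul_le_mul_right (lojmon_le (hP t ht) _) _
      have ht' := ENNReal.toReal_mono (ENNReal.ne_top_of_tsum_ne_top hsumE γ) hb
      rwa [toReal_enorm] at ht')
    h0 (by
      have h1 := hP 0 h0
      exact lojE_summable h1 (ne_top_of_le_ne_top hk (lojN_anti (Nat.le_succ k) F))) h0
  rw [lojE_pderiv_eq]
  simpa [lojE] using this

theorem loj_decomp {n : ℕ} (F : lojC n) : ∃ (c : ℝ) (G : Fin n → lojC n),
    F = algebraMap ℝ (lojC n) c +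
      ∑ i, (⟨MvPowerSeries.monomial (Finsupp.single i 1) 1, monomial_mem_lojC _ _⟩ : lojC n) * G i := by
  obtain ⟨F, k, hk⟩ := F
  obtain ⟨q, r, hq, hF, hr⟩ := loj_division (Finset.univ.image fun i : Fin n => Finsupp.single i 1)
    (fun _ => 0) (by intros; simp) k (by intro β _; simp [lojN]) F hk
  refine ⟨MvPowerSeries.coeff 0 r, fun i => ⟨q (Finsupp.single i 1), k, hq _ (by simp)⟩, ?_⟩
  have hinj : Function.Injective fun i : Fin n => (Finsupp.single i 1 : Fin n →₀ ℕ) := fun i j h =>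
    Finsupp.single_left_injective one_ne_zero h
  have hr' : r = algebraMap ℝ (MvPowerSeries (Fin n) ℝ) (MvPowerSeries.coeff 0 r) := by
    ext α
    by_cases hα : α = 0
    · subst hα
      simp [MvPowerSeries.algebraMap_apply]
    · rw [hr α]
      · rw [MvPowerSeries.algebraMap_apply, MvPowerSeries.coeff_C, if_neg hα]
      · obtain ⟨i, hi⟩ := Finsupp.ne_iff.1 hα
        exact ⟨Finsupp.single i 1, by simp, by
          rw [Finsupp.single_le_iff]; exact Nat.one_le_iff_ne_zero.2 hi⟩
  apply Subtype.ext
  simp only [Subalgebra.coe_add, Subalgebra.coe_algebraMap, AddSubmonoidClass.coe_finsetSum,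
    Subalgebra.coe_mul]
  rw [← hr', add_comm]
  conv_lhs => rw [hF]
  rw [Finset.sum_image hinj.injOn]
  congr 1
  refine Finset.sum_congr rfl fun i _ => ?_
  rw [add_zero, mul_comm]

/-- Coordinate function. -/
noncomputable def lojX {n : ℕ} (i : Fin n) : lojC n :=
  ⟨MvPowerSeries.monomial (Finsupp.single i 1) 1, monomial_mem_lojC _ _⟩

/-- Partial derivative on convergent series. -/
noncomputable def lojD {n : ℕ} (i : Fin n) (F : lojC n) : lojC n :=
  ⟨MvPowerSeries.pderiv ℝ i F, loj_pderiv_mem F.2 i⟩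

theorem lojD_add {n : ℕ} (i : Fin n) (F G : lojC n) : lojD i (F + G) = lojD i F + lojD i G :=
  Subtype.ext (map_add _ _ _)

theorem lojD_const {n : ℕ} (i : Fin n) (c : ℝ) : lojD i (algebraMap ℝ (lojC n) c) = 0 :=
  Subtype.ext ((MvPowerSeries.pderiv ℝ i).map_algebraMap c)

theorem lojD_mul {n : ℕ} (i : Fin n) (F G : lojC n) :
    lojD i (F * G) = F * lojD i G + G * lojD i F :=
  Subtype.ext ((MvPowerSeries.pderiv ℝ i).leibniz _ _)

theorem lojD_X {n : ℕ} (i j : Fin n) : lojD i (lojX j) = if i = j then 1 else 0 := by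
  apply Subtype.ext
  show MvPowerSeries.pderiv ℝ i (MvPowerSeries.X j) = _
  rw [MvPowerSeries.pderiv_X]
  by_cases h : i = j
  · subst h; simp
  · rw [if_neg h, Pi.single_eq_of_ne (Ne.symm h)]; rfl

theorem loj_chain {n : ℕ} {Q : Type*} [CommRing Q] [Algebra ℝ Q] (θ : lojC n →ₐ[ℝ] Q)
    (D : Derivation ℝ Q Q) (y : Q) (N : ℕ) (hy : y ^ N = 0) (hX : ∀ i, y ∣ θ (lojX i)) (F : lojC n) :
    D (θ F) = ∑ i, θ (lojD i F) * D (θ (lojX i)) := by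
  set E : lojC n → Q := fun F => D (θ F) - ∑ i, θ (lojD i F) * D (θ (lojX i)) with hE
  have hadd : ∀ F G, E (F + G) = E F + E G := by
    intro F G
    simp only [hE, map_add, lojD_add, add_mul, Finset.sum_add_distrib]; ring
  have hmul : ∀ F G, E (F * G) = θ F * E G + θ G * E F := by
    intro F G
    simp only [hE, map_mul, lojD_mul, map_add, D.leibniz, smul_eq_mul, add_mul,
      Finset.sum_add_distrib, mul_sub, Finset.mul_sum, mul_assoc]
    ring
  have hconst : ∀ c, E (algebraMap ℝ _ c) = 0 := by
    intro c
    simp [hE, lojD_const]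
  have hXX : ∀ j, E (lojX j) = 0 := by
    intro j
    simp [hE, lojD_X]
  have hsum : ∀ (s : Finset (Fin n)) (G : Fin n → lojC n), E (∑ i ∈ s, G i) = ∑ i ∈ s, E (G i) := by
    intro s G
    induction s using Finset.induction_on with
    | empty => simpa using hconst 0
    | insert a s ha ih => rw [Finset.sum_insert ha, Finset.sum_insert ha, hadd, ih]
  have key : ∀ m F, y ^ m ∣ E F := by
    intro m
    induction m with
    | zero => intro F; simp
    | succ m ih =>
      intro F
      obtain ⟨c, G, hG⟩ := loj_decomp F
      rw [hG, hadd, hconst, zero_add, hsum]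
      refine Finset.dvd_sum fun i _ => ?_
      change _ ∣ E (lojX i * G i)
      rw [hmul, hXX, mul_zero, add_zero, pow_succ']
      exact mul_dvd_mul (hX i) (ih _)
  have h0 : E F = 0 := by
    have := key N F
    rwa [hy, zero_dvd_iff] at this
  exact sub_eq_zero.1 h0

theorem loj_abstract {n : ℕ} {K : Type*} [Field K] [Algebra ℝ K] (O : Subalgebra ℝ K)
    (ev : lojC n →ₐ[ℝ] K) (hev : ∀ F, ev F ∈ O) (y : K) (hy0 : y ≠ 0) (hyO : y ∈ O) (hyi : y⁻¹ ∉ O)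
    (u : Fin n → K) (hX : ∀ i, ev (lojX i) / y ∈ O) (hu : ∀ i, u i / y ∈ O)
    (F : lojC n) (hF0 : MvPowerSeries.coeff 0 (F : MvPowerSeries (Fin n) ℝ) = 0) (hF : ev F ≠ 0)
    (hD : ∀ i, ev (lojD i F) = ev F * u i) : False := by
  letI : Algebra (lojC n) K := ev.toRingHom.toAlgebra
  have hmap : ∀ a, algebraMap (lojC n) K a = ev a := fun a => rfl
  haveI : IsScalarTower ℝ (lojC n) K := IsScalarTower.of_algebraMap_eq fun c => by
    rw [hmap]; exact (ev.commutes c).symm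
  let v : Option (Fin n ⊕ Fin n) → K := fun o => match o with
    | none => y
    | some (Sum.inl i) => ev (lojX i) / y
    | some (Sum.inr i) => u i / y
  let ψ : MvPolynomial (Option (Fin n ⊕ Fin n)) (lojC n) →ₐ[ℝ] K :=
    (MvPolynomial.aeval v).restrictScalars ℝ
  have hv : ∀ o, v o ∈ O := by
    rintro (_ | i | i)
    · exact hyO
    · exact hX i
    · exact hu i
  have hψO : ∀ p, ψ p ∈ O := by
    intro p
    induction p using MvPolynomial.induction_on with
    | C a => 
      have : ψ (MvPolynomial.C a) = ev a := by
        show MvPolynomial.aeval v (MvPolynomial.C a) = _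
        rw [MvPolynomial.aeval_C, hmap]
      rw [this]; exact hev a
    | add p q hp hq => rw [map_add]; exact O.add_mem hp hq
    | mul_X p i hp =>
      rw [map_mul]
      refine O.mul_mem hp ?_
      show MvPolynomial.aeval v (MvPolynomial.X i) ∈ O
      rw [MvPolynomial.aeval_X]; exact hv i
  have hψX : ∀ o, ψ (MvPolynomial.X o) = v o := fun o => MvPolynomial.aeval_X _ _
  have hψC : ∀ a, ψ (MvPolynomial.C a) = ev a := fun a => MvPolynomial.aeval_C _ _
  let B := ψ.range
  haveI : IsNoetherianRing B := isNoetherianRing_of_surjective _ _ ψ.rangeRestrict.toRingHom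
    ψ.rangeRestrict_surjective
  let evB : lojC n →ₐ[ℝ] B := ev.codRestrict B fun a => ⟨MvPolynomial.C a, hψC a⟩
  let yB : B := ⟨y, MvPolynomial.X none, hψX none⟩
  let xB : Fin n → B := fun i => ⟨ev (lojX i) / y, MvPolynomial.X (some (Sum.inl i)), hψX _⟩
  let uB : Fin n → B := fun i => ⟨u i / y, MvPolynomial.X (some (Sum.inr i)), hψX _⟩
  have hxy : ∀ i, evB (lojX i) = yB * xB i := fun i => Subtype.ext (by
    show ev (lojX i) = y * (ev (lojX i) / y)
    rw [mul_div_cancel₀ _ hy0])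
  have hDB : ∀ i, evB (lojD i F) = evB F * yB * uB i := fun i => Subtype.ext (by
    show ev (lojD i F) = ev F * y * (u i / y)
    rw [hD, mul_assoc, mul_div_cancel₀ _ hy0])
  obtain ⟨c, G, hG⟩ := loj_decomp F
  have hc : c = 0 := by
    have := congrArg (fun F : lojC n => MvPowerSeries.coeff 0 (F : MvPowerSeries (Fin n) ℝ)) hG
    simp only [hF0, Subalgebra.coe_add, Subalgebra.coe_algebraMap, AddSubmonoidClass.coe_finsetSum,
      Subalgebra.coe_mul, map_add, map_sum, 
      MvPowerSeries.algebraMap_apply] at this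
    rw [Finset.sum_eq_zero] at this
    · simpa using this.symm
    · intro i _
      rw [MvPowerSeries.coeff_mul, Finset.HasAntidiagonal.antidiagonal_zero, Finset.sum_singleton,
        MvPowerSeries.coeff_monomial_ne, zero_mul]
      intro h
      have := DFunLike.congr_fun h i
      simp at this
  have hdvd : yB ∣ evB F := by
    rw [hG, hc, map_zero, zero_add, map_sum]
    refine Finset.dvd_sum fun i _ => ?_
    change yB ∣ evB (lojX i * G i)
    rw [map_mul, hxy, mul_assoc]
    exact dvd_mul_right _ _
  obtain ⟨Q, _, _, φ, D, N, h1, h2, h3⟩ := loj_thmA (k := ℝ) yB (evB F)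
    (fun h => hy0 (congrArg Subtype.val h))
    (fun h => by
      obtain ⟨⟨w, p, hp⟩, hw⟩ := h.exists_right_inv
      have hw' : y * w = 1 := congrArg Subtype.val hw
      apply hyi
      rw [inv_eq_of_mul_eq_one_right hw', ← hp]
      exact hψO p)
    (fun h => hF (congrArg Subtype.val h)) hdvd
  apply h3
  have := loj_chain (φ.comp evB) D (φ yB) N h1 (fun i => by
    show φ yB ∣ φ (evB (lojX i))
    rw [hxy, map_mul]; exact dvd_mul_right _ _) F
  change D (φ (evB F)) = _ at this
  rw [this]
  refine Finset.sum_eq_zero fun i _ => ?_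
  change φ (evB (lojD i F)) * _ = 0
  rw [hDB, map_mul, h2, zero_mul, zero_mul]

theorem lojE_at_zero {n : ℕ} (F : MvPowerSeries (Fin n) ℝ) : lojE F 0 = MvPowerSeries.coeff 0 F := by
  unfold lojE
  rw [tsum_eq_single 0]
  · rw [lojmon_zero, mul_one]
  · intro α hα
    obtain ⟨i, hi⟩ := Finsupp.ne_iff.1 hα
    rw [lojmon_erase _ _ i]
    simp at hi
    simp [hi]

theorem loj_grad {n : ℕ} {f : EuclideanSpace ℝ (Fin n) → ℝ} (hf : AnalyticAt ℝ f 0)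
    {F : MvPowerSeries (Fin n) ℝ} (hF : F ∈ lojC n) (hfF : ∀ᶠ x in nhds 0, f x = lojE F x) (i : Fin n) :
    ∀ᶠ x in nhds 0, gradient f x i = lojE (MvPowerSeries.pderiv ℝ i F) x := by
  filter_upwards [lojE_hasDerivAt hF i, hfF.eventually_nhds, hf.eventually_analyticAt] with x h1 h2 h3
  have hd : HasDerivAt (fun t : ℝ => f (x + t • EuclideanSpace.single i (1 : ℝ)))
      (fderiv ℝ f x (EuclideanSpace.single i (1 : ℝ))) 0 := by
    have ha : HasDerivAt (fun t : ℝ => x + t • EuclideanSpace.single i (1 : ℝ))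
        (EuclideanSpace.single i (1 : ℝ)) 0 := by
      simpa using ((hasDerivAt_id (0 : ℝ)).smul_const (EuclideanSpace.single i (1 : ℝ))).const_add x
    have hb : HasFDerivAt f (fderiv ℝ f x) (x + (0 : ℝ) • EuclideanSpace.single i (1 : ℝ)) := by
      rw [zero_smul, add_zero]; exact h3.differentiableAt.hasFDerivAt
    exact hb.comp_hasDerivAt (0 : ℝ) ha
  have heq : (fun t : ℝ => f (x + t • EuclideanSpace.single i (1 : ℝ))) =ᶠ[nhds 0]
      fun t : ℝ => lojE F (x + t • EuclideanSpace.single i (1 : ℝ)) := by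
    have hc : Filter.Tendsto (fun t : ℝ => x + t • EuclideanSpace.single i (1 : ℝ)) (nhds 0) (nhds x) := by
      have : Continuous (fun t : ℝ => x + t • EuclideanSpace.single i (1 : ℝ)) := by fun_prop
      simpa using this.tendsto 0
    exact hc.eventually h2
  have := hd.unique (h1.congr_of_eventuallyEq heq)
  rw [← this]
  have hg := h3.differentiableAt.hasGradientAt.hasFDerivAt.fderiv
  rw [hg, InnerProductSpace.toDual_apply_apply, EuclideanSpace.inner_single_right]
  simp

theorem loj_ultra {X : Type*} (l : Filter X) (S : ℕ → Set X) (hS : Antitone S)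
    (h : ∀ C, ∃ᶠ x in l, x ∈ S C) : ∃ U : Ultrafilter X, (U : Filter X) ≤ l ∧ ∀ C, ∀ᶠ x in (U : Filter X), x ∈ S C := by
  set Λ : Filter X := ⨅ C : ℕ, (l ⊓ Filter.principal (S C)) with hΛ
  have hne : Λ.NeBot := by
    have : Nonempty X := by
      obtain ⟨x, -⟩ := (h 0).exists
      exact ⟨x⟩
    refine Filter.iInf_neBot_of_directed ?_ fun C => Filter.frequently_mem_iff_neBot.1 (h C)
    intro a b
    refine ⟨max a b, ?_, ?_⟩
    · exact inf_le_inf_left _ (Filter.principal_mono.2 (hS (le_max_left _ _)))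
    · exact inf_le_inf_left _ (Filter.principal_mono.2 (hS (le_max_right _ _)))
  have hle : ∀ C, Λ ≤ l ⊓ Filter.principal (S C) := fun C => iInf_le _ C
  refine ⟨Ultrafilter.of Λ, (Ultrafilter.of_le _).trans ((hle 0).trans inf_le_left), fun C => ?_⟩
  have : ((Ultrafilter.of Λ : Ultrafilter X) : Filter X) ≤ Filter.principal (S C) :=
    (Ultrafilter.of_le _).trans ((hle C).trans inf_le_right)
  exact Filter.le_principal_iff.1 this

theorem loj_main {n : ℕ} {f : EuclideanSpace ℝ (Fin n) → ℝ} (hf : AnalyticAt ℝ f 0) (hf0 : f 0 = 0) :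
    ∃ C : ℝ, ∀ᶠ x in nhds 0, |f x| ≤ C * ‖gradient f x‖ := by
  by_contra hcon
  obtain ⟨F, hF, hfF⟩ := loj_analytic hf
  obtain ⟨U, hU, hS⟩ := loj_ultra (nhds (0 : EuclideanSpace ℝ (Fin n)))
    (fun C : ℕ => {x | (C : ℝ) * ‖gradient f x‖ < |f x|})
    (by
      intro a b hab x hx
      have hx' : (b : ℝ) * ‖gradient f x‖ < |f x| := hx
      show (a : ℝ) * ‖gradient f x‖ < |f x|
      refine lt_of_le_of_lt ?_ hx'
      gcongr)
    (by
      intro C hC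
      apply hcon
      refine ⟨C, hC.mono fun x hx => not_lt.1 hx⟩)
  have hfne : ∀ᶠ x in (U : Filter _), f x ≠ 0 := by
    filter_upwards [hS 0] with x hx
    have hx' : ((0 : ℕ) : ℝ) * ‖gradient f x‖ < |f x| := hx
    rw [Nat.cast_zero, zero_mul] at hx'
    exact abs_pos.1 hx'
  have hxne : ¬ ∀ᶠ x in (U : Filter (EuclideanSpace ℝ (Fin n))), x = 0 := by
    intro h
    obtain ⟨x, h1, h2⟩ := (h.and hfne).exists
    exact h2 (h1 ▸ hf0)
  let K := Filter.Germ (U : Filter (EuclideanSpace ℝ (Fin n))) ℝ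
  let J : (EuclideanSpace ℝ (Fin n) → ℝ) →+* K := Filter.Germ.coeRingHom _
  have hJ : ∀ {a b}, J a = J b ↔ ∀ᶠ x in (U : Filter _), a x = b x := fun {a b} => Filter.Germ.coe_eq
  letI : Algebra ℝ K := (J.comp (Pi.constRingHom _ ℝ)).toAlgebra
  have halg : ∀ c : ℝ, algebraMap ℝ K c = J fun _ => c := fun c => rfl
  have hJdiv : ∀ a b, J a / J b = J fun x => a x / b x := fun a b => rfl
  have hJinv : ∀ b, (J b)⁻¹ = J fun x => (b x)⁻¹ := fun b => rfl
  have hJmul : ∀ a b, J a * J b = J fun x => a x * b x := fun a b => rfl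
  have hJadd : ∀ a b, J a + J b = J fun x => a x + b x := fun a b => rfl
  let O : Subalgebra ℝ K :=
    { carrier := {z | ∃ M : ℝ, ∃ a, z = J a ∧ ∀ᶠ x in (U : Filter _), |a x| ≤ M}
      mul_mem' := by
        rintro _ _ ⟨M, a, rfl, ha⟩ ⟨M', b, rfl, hb⟩
        refine ⟨M * M', _, hJmul a b, ?_⟩
        filter_upwards [ha, hb] with x h1 h2
        rw [abs_mul]
        exact mul_le_mul h1 h2 (abs_nonneg _) ((abs_nonneg _).trans h1)
      add_mem' := by
        rintro _ _ ⟨M, a, rfl, ha⟩ ⟨M', b, rfl, hb⟩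
        refine ⟨M + M', _, hJadd a b, ?_⟩
        filter_upwards [ha, hb] with x h1 h2
        exact (abs_add_le _ _).trans (add_le_add h1 h2)
      algebraMap_mem' := fun c => ⟨|c|, _, halg c, Filter.Eventually.of_forall fun _ => le_rfl⟩ }
  have hO : ∀ z, z ∈ O ↔ ∃ M : ℝ, ∃ a, z = J a ∧ ∀ᶠ x in (U : Filter _), |a x| ≤ M := fun z => Iff.rfl
  have hc : ∀ c : ℝ, J (lojE (algebraMap ℝ (MvPowerSeries (Fin n) ℝ) c)) = algebraMap ℝ K c := by
    intro c
    rw [halg, hJ]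
    refine Filter.Eventually.of_forall fun x => ?_
    have := lojE_monomial 0 c x
    rw [lojmon_zero, mul_one] at this
    exact this
  let ev : lojC n →ₐ[ℝ] K :=
    { toFun := fun F => J (lojE F)
      map_one' := by
        have := hc 1
        rwa [map_one, map_one] at this
      map_zero' := by
        have := hc 0
        rwa [map_zero, map_zero] at this
      map_mul' := fun F G => by
        show J (lojE (F * G : MvPowerSeries (Fin n) ℝ)) = _
        rw [hJmul, hJ]; exact hU (lojE_mul F.2 G.2)
      map_add' := fun F G => by
        show J (lojE (F + G : MvPowerSeries (Fin n) ℝ)) = _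
        rw [hJadd, hJ]; exact hU (lojE_add F.2 G.2)
      commutes' := hc }
  have hev : ∀ F, ev F = J (lojE F) := fun F => rfl
  let w : Fin n ⊕ Fin n → EuclideanSpace ℝ (Fin n) → ℝ := fun o => match o with
    | Sum.inl i => fun x => x i
    | Sum.inr i => fun x => gradient f x i / f x
  have hinf : ∀ o, ∀ ε > (0 : ℝ), ∀ᶠ x in (U : Filter _), |w o x| < ε := by
    rintro (i | i) ε hε
    · have hcont : Continuous fun x : EuclideanSpace ℝ (Fin n) => |x i| := by fun_prop
      have : ∀ᶠ x : EuclideanSpace ℝ (Fin n) in nhds 0, |x i| < ε :=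
        hcont.continuousAt.eventually_lt continuousAt_const (by simpa using hε)
      exact hU this
    · obtain ⟨C, hC⟩ := exists_nat_gt (1 / ε)
      filter_upwards [hS C, hfne] with x hx hx0
      have hx' : (C : ℝ) * ‖gradient f x‖ < |f x| := hx
      show |gradient f x i / f x| < ε
      rw [abs_div, div_lt_iff₀ (abs_pos.2 hx0)]
      have h1 : |gradient f x i| ≤ ‖gradient f x‖ := by
        simpa using PiLp.norm_apply_le (gradient f x) i
      have h2 : 1 < C * ε := by rwa [div_lt_iff₀ hε] at hC
      have h3 : ‖gradient f x‖ ≤ (C * ε) * ‖gradient f x‖ :=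
        le_mul_of_one_le_left (norm_nonneg _) h2.le
      nlinarith
  have hne : Nonempty (Fin n ⊕ Fin n) := by
    by_contra h
    rw [not_nonempty_iff] at h
    apply hxne
    refine Filter.Eventually.of_forall fun x => ?_
    ext i
    exact (h.false (Sum.inl i)).elim
  obtain ⟨o, -, ho⟩ := Finset.exists_max_image (Finset.univ : Finset (Fin n ⊕ Fin n))
    (fun o => (((fun x => |w o x|) : EuclideanSpace ℝ (Fin n) → ℝ) : K)) Finset.univ_nonempty
  have ho' : ∀ o', ∀ᶠ x in (U : Filter _), |w o' x| ≤ |w o x| := fun o' =>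
    Filter.Germ.coe_le.1 (ho o' (Finset.mem_univ _))
  have hy0 : J (w o) ≠ 0 := by
    intro h
    rw [← map_zero J, hJ] at h
    apply hxne
    have := Filter.eventually_all.2 fun i : Fin n => ho' (Sum.inl i)
    filter_upwards [this, h] with x h1 h2
    ext i
    have h3 := h1 i
    rw [h2] at h3
    simp only [Pi.zero_apply, abs_zero] at h3
    exact abs_nonpos_iff.1 h3
  have hw0 : ∀ᶠ x in (U : Filter _), w o x ≠ 0 := by
    rw [Ne, ← map_zero J, hJ] at hy0
    exact Ultrafilter.eventually_not.2 hy0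
  have hdivO : ∀ o', J (w o') / J (w o) ∈ O := by
    intro o'
    rw [hO, hJdiv]
    refine ⟨1, _, rfl, ?_⟩
    filter_upwards [ho' o'] with x hx
    rw [abs_div]
    exact div_le_one_of_le₀ hx (abs_nonneg _)
  refine loj_abstract O ev ?_ (J (w o)) hy0 ?_ ?_ (fun i => J (w (Sum.inr i))) ?_ ?_ ⟨F, hF⟩ ?_ ?_ ?_
  · intro G
    obtain ⟨M, hM⟩ := lojE_bdd G.2
    exact ⟨M, _, rfl, hU hM⟩
  · exact ⟨1, _, rfl, (hinf o 1 one_pos).mono fun x hx => hx.le⟩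
  · rintro ⟨M, a, ha, hM⟩
    rw [hJinv, hJ] at ha
    obtain ⟨x, h1, h2, h3, h4⟩ := (ha.and (hM.and (hw0.and (hinf o (1 / (|M| + 1)) (by positivity))))).exists
    rw [← h1, abs_inv] at h2
    have h5 : |M| + 1 < |w o x|⁻¹ := by
      rw [lt_inv_comm₀ (by positivity) (abs_pos.2 h3)]
      simpa using h4
    linarith [le_abs_self M]
  · intro i
    have : ev (lojX i) = J (w (Sum.inl i)) := by
      rw [hev, hJ]
      refine Filter.Eventually.of_forall fun x => ?_
      show lojE (MvPowerSeries.monomial (Finsupp.single i 1) 1) x = x i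
      rw [lojE_monomial, lojmon_single]; simp
    rw [this]
    exact hdivO (Sum.inl i)
  · intro i
    exact hdivO (Sum.inr i)
  · have := hfF.self_of_nhds
    rw [hf0, lojE_at_zero] at this
    exact this.symm
  · intro h
    rw [hev, ← map_zero J, hJ] at h
    obtain ⟨x, h1, h2, h3⟩ := (h.and (hfne.and (hU hfF))).exists
    apply h2
    rw [h3]; exact h1
  · intro i
    rw [hev, hev, hJmul, hJ]
    filter_upwards [hU (loj_grad hf hF hfF i), hfne, hU hfF] with x h1 h2 h3
    show lojE (MvPowerSeries.pderiv ℝ i F) x = lojE F x * (gradient f x i / f x)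
    rw [← h1, ← h3, mul_div_cancel₀ _ h2]

/-- Symbol classes: `u` is bounded by `ρ ^ m`, with each derivative costing one power of `ρ`. -/
def lojS {n : ℕ} (ρ : ℝ × EuclideanSpace ℝ (Fin n) → ℝ) (Ω : Set (ℝ × EuclideanSpace ℝ (Fin n))) :
    ℕ → ℤ → (ℝ × EuclideanSpace ℝ (Fin n) → ℝ) → Prop
  | 0, m, u => ∃ C : ℝ, ∀ p ∈ Ω, |u p| ≤ C * ρ p ^ m
  | L + 1, m, u => (∃ C : ℝ, ∀ p ∈ Ω, |u p| ≤ C * ρ p ^ m) ∧ (∀ p ∈ Ω, DifferentiableAt ℝ u p) ∧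
      ∀ v : Fin (n + 1), lojS ρ Ω L (m - 1) (pdP (basisP n v) u)

theorem lojS_bound {n : ℕ} {ρ : ℝ × EuclideanSpace ℝ (Fin n) → ℝ} {Ω : Set (ℝ × EuclideanSpace ℝ (Fin n))}
    {L : ℕ} {m : ℤ} {u : ℝ × EuclideanSpace ℝ (Fin n) → ℝ} (h : lojS ρ Ω L m u) :
    ∃ C : ℝ, ∀ p ∈ Ω, |u p| ≤ C * ρ p ^ m := by
  cases L with
  | zero => exact h
  | succ L => exact h.1

theorem lojS_succ {n : ℕ} {ρ : ℝ × EuclideanSpace ℝ (Fin n) → ℝ} {Ω : Set (ℝ × EuclideanSpace ℝ (Fin n))}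
    (L : ℕ) : ∀ (m : ℤ) (u : ℝ × EuclideanSpace ℝ (Fin n) → ℝ), lojS ρ Ω (L + 1) m u → lojS ρ Ω L m u := by
  induction L with
  | zero => intro m u h; exact h.1
  | succ L ih => intro m u h; exact ⟨h.1, h.2.1, fun v => ih _ _ (h.2.2 v)⟩

theorem lojS_subset {n : ℕ} {ρ : ℝ × EuclideanSpace ℝ (Fin n) → ℝ} {Ω Ω' : Set (ℝ × EuclideanSpace ℝ (Fin n))}
    (hΩ : Ω' ⊆ Ω) (L : ℕ) : ∀ (m : ℤ) (u : ℝ × EuclideanSpace ℝ (Fin n) → ℝ),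
    lojS ρ Ω L m u → lojS ρ Ω' L m u := by
  induction L with
  | zero => rintro m u ⟨C, hC⟩; exact ⟨C, fun p hp => hC p (hΩ hp)⟩
  | succ L ih =>
    rintro m u ⟨⟨C, hC⟩, hd, h⟩
    exact ⟨⟨C, fun p hp => hC p (hΩ hp)⟩, fun p hp => hd p (hΩ hp), fun v => ih _ _ (h v)⟩

theorem lojS_mono {n : ℕ} {ρ : ℝ × EuclideanSpace ℝ (Fin n) → ℝ} {Ω : Set (ℝ × EuclideanSpace ℝ (Fin n))}
    (hρ : ∀ p ∈ Ω, 0 < ρ p ∧ ρ p ≤ 1) (L : ℕ) :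
    ∀ (m m' : ℤ) (u : ℝ × EuclideanSpace ℝ (Fin n) → ℝ), m' ≤ m → lojS ρ Ω L m u → lojS ρ Ω L m' u := by
  have hb : ∀ (m m' : ℤ) (u : ℝ × EuclideanSpace ℝ (Fin n) → ℝ), m' ≤ m →
      (∃ C : ℝ, ∀ p ∈ Ω, |u p| ≤ C * ρ p ^ m) → ∃ C : ℝ, ∀ p ∈ Ω, |u p| ≤ C * ρ p ^ m' := by
    rintro m m' u hm ⟨C, hC⟩
    refine ⟨|C|, fun p hp => (hC p hp).trans ?_⟩
    have h1 : ρ p ^ m ≤ ρ p ^ m' := zpow_le_zpow_right_of_le_one₀ (hρ p hp).1 (hρ p hp).2 hm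
    have h2 : 0 ≤ ρ p ^ m := zpow_nonneg (hρ p hp).1.le m
    exact mul_le_mul (le_abs_self C) h1 h2 (abs_nonneg _)
  induction L with
  | zero => intro m m' u hm h; exact hb m m' u hm h
  | succ L ih =>
    intro m m' u hm h
    exact ⟨hb m m' u hm h.1, h.2.1, fun v => ih _ _ _ (by omega) (h.2.2 v)⟩

theorem lojS_congr {n : ℕ} {ρ : ℝ × EuclideanSpace ℝ (Fin n) → ℝ} {Ω : Set (ℝ × EuclideanSpace ℝ (Fin n))}
    (hΩ : IsOpen Ω) (L : ℕ) :
    ∀ (m : ℤ) (u u' : ℝ × EuclideanSpace ℝ (Fin n) → ℝ), (∀ p ∈ Ω, u p = u' p) →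
      lojS ρ Ω L m u → lojS ρ Ω L m u' := by
  have hb : ∀ (m : ℤ) (u u' : ℝ × EuclideanSpace ℝ (Fin n) → ℝ), (∀ p ∈ Ω, u p = u' p) →
      (∃ C : ℝ, ∀ p ∈ Ω, |u p| ≤ C * ρ p ^ m) → ∃ C : ℝ, ∀ p ∈ Ω, |u' p| ≤ C * ρ p ^ m := by
    rintro m u u' h ⟨C, hC⟩
    exact ⟨C, fun p hp => h p hp ▸ hC p hp⟩
  induction L with
  | zero => intro m u u' he h; exact hb m u u' he h
  | succ L ih =>
    intro m u u' he h
    have hev : ∀ p ∈ Ω, u =ᶠ[nhds p] u' := fun p hp =>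
      Filter.eventually_of_mem (hΩ.mem_nhds hp) he
    refine ⟨hb m u u' he h.1, fun p hp => (hev p hp).differentiableAt_iff.1 (h.2.1 p hp),
      fun v => ih _ _ _ (fun p hp => ?_) (h.2.2 v)⟩
    unfold pdP
    rw [(hev p hp).fderiv_eq]

theorem lojS_add {n : ℕ} {ρ : ℝ × EuclideanSpace ℝ (Fin n) → ℝ} {Ω : Set (ℝ × EuclideanSpace ℝ (Fin n))}
    (hΩ : IsOpen Ω) (L : ℕ) :
    ∀ (m : ℤ) (u u' : ℝ × EuclideanSpace ℝ (Fin n) → ℝ),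
      lojS ρ Ω L m u → lojS ρ Ω L m u' → lojS ρ Ω L m (fun p => u p + u' p) := by
  have hb : ∀ (m : ℤ) (u u' : ℝ × EuclideanSpace ℝ (Fin n) → ℝ),
      (∃ C : ℝ, ∀ p ∈ Ω, |u p| ≤ C * ρ p ^ m) → (∃ C : ℝ, ∀ p ∈ Ω, |u' p| ≤ C * ρ p ^ m) →
      ∃ C : ℝ, ∀ p ∈ Ω, |u p + u' p| ≤ C * ρ p ^ m := by
    rintro m u u' ⟨C, hC⟩ ⟨C', hC'⟩
    refine ⟨C + C', fun p hp => (abs_add_le _ _).trans ?_⟩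
    rw [add_mul]
    exact add_le_add (hC p hp) (hC' p hp)
  induction L with
  | zero => intro m u u' h h'; exact hb m u u' h h'
  | succ L ih =>
    intro m u u' h h'
    refine ⟨hb m u u' h.1 h'.1, fun p hp => (h.2.1 p hp).add (h'.2.1 p hp), fun v => ?_⟩
    refine lojS_congr hΩ L _ _ _ (fun p hp => ?_) (ih _ _ _ (h.2.2 v) (h'.2.2 v))
    unfold pdP
    rw [fderiv_fun_add (h.2.1 p hp) (h'.2.1 p hp)]
    rfl

theorem lojS_mul {n : ℕ} {ρ : ℝ × EuclideanSpace ℝ (Fin n) → ℝ} {Ω : Set (ℝ × EuclideanSpace ℝ (Fin n))}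
    (hΩ : IsOpen Ω) (hρ : ∀ p ∈ Ω, 0 < ρ p ∧ ρ p ≤ 1) (L : ℕ) :
    ∀ (m m' : ℤ) (u u' : ℝ × EuclideanSpace ℝ (Fin n) → ℝ),
      lojS ρ Ω L m u → lojS ρ Ω L m' u' → lojS ρ Ω L (m + m') (fun p => u p * u' p) := by
  have hb : ∀ (m m' : ℤ) (u u' : ℝ × EuclideanSpace ℝ (Fin n) → ℝ),
      (∃ C : ℝ, ∀ p ∈ Ω, |u p| ≤ C * ρ p ^ m) → (∃ C : ℝ, ∀ p ∈ Ω, |u' p| ≤ C * ρ p ^ m') →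
      ∃ C : ℝ, ∀ p ∈ Ω, |u p * u' p| ≤ C * ρ p ^ (m + m') := by
    rintro m m' u u' ⟨C, hC⟩ ⟨C', hC'⟩
    refine ⟨C * C', fun p hp => ?_⟩
    rw [abs_mul, zpow_add₀ (hρ p hp).1.ne']
    calc |u p| * |u' p| ≤ (C * ρ p ^ m) * (C' * ρ p ^ m') :=
          mul_le_mul (hC p hp) (hC' p hp) (abs_nonneg _) ((abs_nonneg _).trans (hC p hp))
      _ = _ := by ring
  induction L with
  | zero => intro m m' u u' h h'; exact hb m m' u u' h h'
  | succ L ih =>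
    intro m m' u u' h h'
    refine ⟨hb m m' u u' h.1 h'.1, fun p hp => (h.2.1 p hp).mul (h'.2.1 p hp), fun v => ?_⟩
    have h1 := ih _ _ _ _ (lojS_succ L _ _ h) (h'.2.2 v)
    have h2 := ih _ _ _ _ (h.2.2 v) (lojS_succ L _ _ h')
    rw [show m + (m' - 1) = m + m' - 1 by ring] at h1
    rw [show m - 1 + m' = m + m' - 1 by ring] at h2
    refine lojS_congr hΩ L _ _ _ (fun p hp => ?_) (lojS_add hΩ L _ _ _ h1 h2)
    unfold pdP
    rw [fderiv_fun_mul (h.2.1 p hp) (h'.2.1 p hp)]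
    simp [mul_comm]

theorem lojS_const {n : ℕ} {ρ : ℝ × EuclideanSpace ℝ (Fin n) → ℝ} {Ω : Set (ℝ × EuclideanSpace ℝ (Fin n))}
    (hρ : ∀ p ∈ Ω, 0 < ρ p ∧ ρ p ≤ 1) (L : ℕ) :
    ∀ c : ℝ, lojS ρ Ω L 0 (fun _ => c) := by
  induction L with
  | zero => intro c; exact ⟨|c|, fun p _ => by simp⟩
  | succ L ih =>
    intro c
    refine ⟨⟨|c|, fun p _ => by simp⟩, fun p _ => differentiableAt_const _, fun v => ?_⟩
    have : pdP (basisP n v) (fun _ => c) = fun _ => 0 := by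
      funext p; simp [pdP]
    rw [this]
    exact lojS_mono hρ L _ _ _ (by norm_num) (ih 0)

theorem lojS_pow {n : ℕ} {ρ : ℝ × EuclideanSpace ℝ (Fin n) → ℝ} {Ω : Set (ℝ × EuclideanSpace ℝ (Fin n))}
    (hΩ : IsOpen Ω) (hρ : ∀ p ∈ Ω, 0 < ρ p ∧ ρ p ≤ 1) (L : ℕ) (u : ℝ × EuclideanSpace ℝ (Fin n) → ℝ)
    (h : lojS ρ Ω L 1 u) (s : ℕ) : lojS ρ Ω L s (fun p => u p ^ s) := by
  induction s with
  | zero => simpa using lojS_const hρ L 1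
  | succ s ih =>
    have := lojS_mul hΩ hρ L _ _ _ _ ih h
    simpa [pow_succ] using this

theorem lojS_sum {n : ℕ} {ρ : ℝ × EuclideanSpace ℝ (Fin n) → ℝ} {Ω : Set (ℝ × EuclideanSpace ℝ (Fin n))}
    (hΩ : IsOpen Ω) (hρ : ∀ p ∈ Ω, 0 < ρ p ∧ ρ p ≤ 1) (L : ℕ) (m : ℤ) {ι : Type*} (s : Finset ι)
    (u : ι → ℝ × EuclideanSpace ℝ (Fin n) → ℝ)
    (h : ∀ i, lojS ρ Ω L m (u i)) (hm : 0 ≤ m) : lojS ρ Ω L m (fun p => ∑ i ∈ s, u i p) := by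
  have hzero : ∀ (L : ℕ) (m : ℤ), lojS ρ Ω L m (fun _ => 0) := by
    intro L
    induction L with
    | zero => intro m; exact ⟨0, fun p _ => by simp⟩
    | succ L ih =>
      intro m
      refine ⟨⟨0, fun p _ => by simp⟩, fun p _ => differentiableAt_const _, fun v => ?_⟩
      have : pdP (basisP n v) (fun _ => (0 : ℝ)) = fun _ => 0 := by
        funext p; simp [pdP]
      rw [this]
      exact ih _
  induction s using Finset.induction_on with
  | empty => simpa using hzero L m
  | insert a s ha ih =>
    simp only [Finset.sum_insert ha]
    exact lojS_add hΩ L _ _ _ (h a) ih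

theorem lojS_inv {n : ℕ} {ρ : ℝ × EuclideanSpace ℝ (Fin n) → ℝ} {Ω : Set (ℝ × EuclideanSpace ℝ (Fin n))}
    (hΩ : IsOpen Ω) (hρ : ∀ p ∈ Ω, 0 < ρ p ∧ ρ p ≤ 1) (u : ℝ × EuclideanSpace ℝ (Fin n) → ℝ)
    (c : ℝ) (hc : 0 < c) (hu : ∀ p ∈ Ω, c * ρ p ^ 2 ≤ u p) (h : ∀ L, lojS ρ Ω L 2 u) (L : ℕ) :
    lojS ρ Ω L (-2) (fun p => (u p)⁻¹) := by
  have hpos : ∀ p ∈ Ω, 0 < u p := fun p hp =>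
    lt_of_lt_of_le (mul_pos hc (pow_pos (hρ p hp).1 2)) (hu p hp)
  have hb : ∃ C : ℝ, ∀ p ∈ Ω, |(u p)⁻¹| ≤ C * ρ p ^ (-2 : ℤ) := by
    refine ⟨c⁻¹, fun p hp => ?_⟩
    rw [abs_of_pos (inv_pos.2 (hpos p hp)), zpow_neg, ← mul_inv]
    exact inv_anti₀ (mul_pos hc (zpow_pos (hρ p hp).1 2)) (by exact_mod_cast hu p hp)
  induction L with
  | zero => exact hb
  | succ L ih =>
    refine ⟨hb, fun p hp => ((h 1).2.1 p hp).inv (hpos p hp).ne', fun v => ?_⟩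
    have h1 := lojS_mul hΩ hρ L _ _ _ _ (lojS_mul hΩ hρ L _ _ _ _ ih ih)
      (lojS_mul hΩ hρ L _ _ _ _ (lojS_const hρ L (-1)) ((h (L + 1)).2.2 v))
    norm_num at h1 ⊢
    refine lojS_congr hΩ L _ _ _ (fun p hp => ?_) h1
    unfold pdP
    have hd := (((hasDerivAt_inv (hpos p hp).ne').comp_hasFDerivAt p ((h 1).2.1 p hp).hasFDerivAt)).fderiv
    have he : (Inv.inv ∘ u) = fun p => (u p)⁻¹ := rfl
    rw [he] at hd
    rw [hd]
    simp
    field_simp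
    simp

theorem lojS_iter {n : ℕ} {ρ : ℝ × EuclideanSpace ℝ (Fin n) → ℝ} {Ω : Set (ℝ × EuclideanSpace ℝ (Fin n))}
    (v : Fin (n + 1)) (a L : ℕ) : ∀ (m : ℤ) (u : ℝ × EuclideanSpace ℝ (Fin n) → ℝ),
    lojS ρ Ω (L + a) m u → lojS ρ Ω L (m - a) ((pdP (basisP n v))^[a] u) := by
  induction a with
  | zero => intro m u h; simpa using h
  | succ a ih =>
    intro m u h
    have := ih (m - 1) _ (h.2.2 v)
    rw [Function.iterate_succ_apply]
    rwa [show m - ((a + 1 : ℕ) : ℤ) = m - 1 - a by push_cast; ring]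

theorem lojS_mpd {n : ℕ} {ρ : ℝ × EuclideanSpace ℝ (Fin n) → ℝ} {Ω : Set (ℝ × EuclideanSpace ℝ (Fin n))}
    (α : Fin (n + 1) → ℕ) (m : ℤ) (u : ℝ × EuclideanSpace ℝ (Fin n) → ℝ) (h : ∀ L, lojS ρ Ω L m u) :
    ∃ C : ℝ, ∀ p ∈ Ω, |mpdP α u p| ≤ C * ρ p ^ (m - ((∑ i, α i : ℕ) : ℤ)) := by
  have key : ∀ l : List (Fin (n + 1)), ∀ L, lojS ρ Ω L (m - ((l.map α).sum : ℕ))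
      (l.foldr (fun i k => (pdP (basisP n i))^[α i] k) u) := by
    intro l
    induction l with
    | nil => intro L; simpa using h L
    | cons i l ih =>
      intro L
      have := lojS_iter i (α i) L _ _ (ih (L + α i))
      rw [List.foldr_cons, List.map_cons, List.sum_cons]
      rwa [show m - ((α i + (l.map α).sum : ℕ) : ℤ) = m - ((l.map α).sum : ℕ) - (α i : ℤ) by push_cast; ring]
  have := key (List.finRange (n + 1)) 0
  rw [← Fin.sum_univ_def] at this
  exact this

theorem loj_grad_apply {n : ℕ} (f : EuclideanSpace ℝ (Fin n) → ℝ) (x : EuclideanSpace ℝ (Fin n)) (j : Fin n) :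
    gradient f x j = fderiv ℝ f x (EuclideanSpace.single j 1) := by
  unfold gradient
  rw [← InnerProductSpace.toDual_symm_apply, EuclideanSpace.inner_single_right]
  simp

theorem loj_pdP_snd {n : ℕ} (a : EuclideanSpace ℝ (Fin n) → ℝ) (v p : ℝ × EuclideanSpace ℝ (Fin n))
    (ha : DifferentiableAt ℝ a p.2) : pdP v (fun q => a q.2) p = fderiv ℝ a p.2 v.2 := by
  unfold pdP
  have := (ha.hasFDerivAt.comp p hasFDerivAt_snd).fderiv
  have he : (a ∘ Prod.snd) = fun q : ℝ × EuclideanSpace ℝ (Fin n) => a q.2 := rfl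
  rw [he] at this
  rw [this]
  rfl

theorem lojS_analytic {n : ℕ} {ρ : ℝ × EuclideanSpace ℝ (Fin n) → ℝ} {Ω : Set (ℝ × EuclideanSpace ℝ (Fin n))}
    (hΩ : IsOpen Ω) (hρ : ∀ p ∈ Ω, 0 < ρ p ∧ ρ p ≤ 1) (ε : ℝ) (hε : ∀ p ∈ Ω, ‖p.2‖ ≤ ε) (L : ℕ) :
    ∀ a : EuclideanSpace ℝ (Fin n) → ℝ, AnalyticOnNhd ℝ a (Metric.closedBall 0 ε) →
    lojS ρ Ω L 0 (fun p => a p.2) := by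
  have hmem : ∀ p ∈ Ω, p.2 ∈ Metric.closedBall (0 : EuclideanSpace ℝ (Fin n)) ε := fun p hp => by
    simpa using hε p hp
  have hb : ∀ a : EuclideanSpace ℝ (Fin n) → ℝ, AnalyticOnNhd ℝ a (Metric.closedBall 0 ε) →
      ∃ C : ℝ, ∀ p ∈ Ω, |a p.2| ≤ C * ρ p ^ (0 : ℤ) := by
    intro a ha
    obtain ⟨C, hC⟩ := (isCompact_closedBall (0 : EuclideanSpace ℝ (Fin n)) ε).exists_bound_of_continuousOn
      ha.continuousOn
    exact ⟨C, fun p hp => by simpa using hC _ (hmem p hp)⟩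
  induction L with
  | zero => exact hb
  | succ L ih =>
    intro a ha
    have hd : ∀ p ∈ Ω, DifferentiableAt ℝ a p.2 := fun p hp => (ha _ (hmem p hp)).differentiableAt
    refine ⟨hb a ha, fun p hp => (hd p hp).comp p differentiableAt_snd, fun v => ?_⟩
    have h1 : AnalyticOnNhd ℝ (fun x => fderiv ℝ a x (basisP n v).2) (Metric.closedBall 0 ε) :=
      fun x hx => (ContinuousLinearMap.analyticAt (ContinuousLinearMap.apply ℝ ℝ (basisP n v).2) _).comp (ha.fderiv x hx)
    refine lojS_congr hΩ L _ _ _ (fun p hp => ?_) (lojS_mono hρ L _ _ _ (by norm_num) (ih _ h1))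
    rw [loj_pdP_snd _ _ _ (hd p hp)]

theorem lojS_analytic_one {n : ℕ} {ρ : ℝ × EuclideanSpace ℝ (Fin n) → ℝ} {Ω : Set (ℝ × EuclideanSpace ℝ (Fin n))}
    (hΩ : IsOpen Ω) (hρ : ∀ p ∈ Ω, 0 < ρ p ∧ ρ p ≤ 1) (ε : ℝ) (hε : ∀ p ∈ Ω, ‖p.2‖ ≤ ε)
    (a : EuclideanSpace ℝ (Fin n) → ℝ) (ha : AnalyticOnNhd ℝ a (Metric.closedBall 0 ε))
    (C : ℝ) (hC : ∀ p ∈ Ω, |a p.2| ≤ C * ρ p) (L : ℕ) :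
    lojS ρ Ω L 1 (fun p => a p.2) := by
  have hb : ∃ C : ℝ, ∀ p ∈ Ω, |a p.2| ≤ C * ρ p ^ (1 : ℤ) := ⟨C, fun p hp => by simpa using hC p hp⟩
  cases L with
  | zero => exact hb
  | succ L =>
    have hmem : ∀ p ∈ Ω, p.2 ∈ Metric.closedBall (0 : EuclideanSpace ℝ (Fin n)) ε := fun p hp => by
      simpa using hε p hp
    have hd : ∀ p ∈ Ω, DifferentiableAt ℝ a p.2 := fun p hp => (ha _ (hmem p hp)).differentiableAt
    refine ⟨hb, fun p hp => (hd p hp).comp p differentiableAt_snd, fun v => ?_⟩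
    have h1 : AnalyticOnNhd ℝ (fun x => fderiv ℝ a x (basisP n v).2) (Metric.closedBall 0 ε) :=
      fun x hx => (ContinuousLinearMap.analyticAt (ContinuousLinearMap.apply ℝ ℝ (basisP n v).2) _).comp (ha.fderiv x hx)
    refine lojS_congr hΩ L _ _ _ (fun p hp => ?_) (lojS_analytic hΩ hρ ε hε L _ h1)
    rw [loj_pdP_snd _ _ _ (hd p hp)]

theorem lojS_fst {n : ℕ} {ρ : ℝ × EuclideanSpace ℝ (Fin n) → ℝ} {Ω : Set (ℝ × EuclideanSpace ℝ (Fin n))}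
    (hρ : ∀ p ∈ Ω, 0 < ρ p ∧ ρ p ≤ 1) (h3 : ∀ p ∈ Ω, |p.1| ≤ 3) (L : ℕ) :
    lojS ρ Ω L 0 (fun p => p.1) := by
  have hb : ∃ C : ℝ, ∀ p ∈ Ω, |p.1| ≤ C * ρ p ^ (0 : ℤ) := ⟨3, fun p hp => by simpa using h3 p hp⟩
  cases L with
  | zero => exact hb
  | succ L =>
    refine ⟨hb, fun p hp => differentiableAt_fst, fun v => ?_⟩
    have : pdP (basisP n v) (fun p : ℝ × EuclideanSpace ℝ (Fin n) => p.1) = fun _ => (basisP n v).1 := by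
      funext p
      unfold pdP
      rw [hasFDerivAt_fst.fderiv]; rfl
    rw [this]
    exact lojS_mono hρ L _ _ _ (by norm_num) (lojS_const hρ L _)

theorem loj_dist {n : ℕ} {f : EuclideanSpace ℝ (Fin n) → ℝ} (hf : AnalyticAt ℝ f 0) (h0 : gradient f 0 = 0) :
    ∃ K > (0 : ℝ), ∀ᶠ x in nhds 0, ‖gradient f x‖ ≤ K * Metric.infDist x {y | gradient f y = 0} := by
  have hga : AnalyticAt ℝ (gradient f) 0 :=
    (ContinuousLinearMap.analyticAt ((InnerProductSpace.toDual ℝ (EuclideanSpace ℝ (Fin n))).symm.toContinuousLinearEquiv.toContinuousLinearMap) _).comp hf.fderiv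
  obtain ⟨K, t, ht, hK⟩ := (hga.contDiffAt (n := 1)).exists_lipschitzOnWith
  obtain ⟨η, hη, hball⟩ := Metric.mem_nhds_iff.1 ht
  refine ⟨(K : ℝ) + 1, by positivity, ?_⟩
  filter_upwards [Metric.ball_mem_nhds (0 : EuclideanSpace ℝ (Fin n)) (half_pos hη)] with x hx
  have hx' : ‖x‖ < η / 2 := by simpa using hx
  have hpos : (0 : ℝ) < (K : ℝ) + 1 := by positivity
  have h0t : (0 : EuclideanSpace ℝ (Fin n)) ∈ t := hball (Metric.mem_ball_self hη)
  have hxt : x ∈ t := hball (by rw [Metric.mem_ball, dist_zero_right]; linarith)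
  rw [← div_le_iff₀' hpos, Metric.le_infDist (s := {y | gradient f y = 0}) ⟨0, h0⟩]
  intro y hy
  have hy' : gradient f y = 0 := hy
  rw [div_le_iff₀' hpos]
  have hstep : ∀ z ∈ t, gradient f z = 0 → ‖gradient f x‖ ≤ K * dist x z := by
    intro z hz hz0
    have := hK.dist_le_mul x hxt z hz
    rwa [hz0, dist_zero_right] at this
  by_cases hyt : y ∈ Metric.ball (0 : EuclideanSpace ℝ (Fin n)) η
  · refine (hstep y (hball hyt) hy').trans ?_
    gcongr; linarith
  · have hyn : η ≤ ‖y‖ := by simpa using hyt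
    have h1 : dist x 0 ≤ dist x y := by
      rw [dist_zero_right, dist_eq_norm]
      have := norm_sub_norm_le y x
      rw [norm_sub_rev] at this
      linarith
    refine (hstep 0 h0t h0).trans ?_
    have : (K : ℝ) * dist x 0 ≤ K * dist x y := by gcongr
    nlinarith [dist_nonneg (x := x) (y := y)]

theorem loj_norm_le {n : ℕ} (v : EuclideanSpace ℝ (Fin n)) : ‖v‖ ≤ ∑ j, |v j| := by
  have h := (EuclideanSpace.basisFun (Fin n) ℝ).sum_repr v
  calc ‖v‖ = ‖∑ i, (EuclideanSpace.basisFun (Fin n) ℝ).repr v i • (EuclideanSpace.basisFun (Fin n) ℝ) i‖ := by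
        rw [h]
    _ ≤ ∑ i, ‖(EuclideanSpace.basisFun (Fin n) ℝ).repr v i • (EuclideanSpace.basisFun (Fin n) ℝ) i‖ :=
        norm_sum_le _ _
    _ = _ := by
        refine Finset.sum_congr rfl fun i _ => ?_
        rw [norm_smul, OrthonormalBasis.norm_eq_one, mul_one]
        simp

theorem loj_final {n : ℕ} (f g : EuclideanSpace ℝ (Fin n) → ℝ) (r : ℕ) (hr : 1 ≤ r)
    (hf : AnalyticAt ℝ f 0) (hg : AnalyticAt ℝ g 0) (hf0 : f 0 = 0)
    (hgrad : gradient f 0 = 0)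
    (hmem : ∃ h : EuclideanSpace ℝ (Fin n) → ℝ, AnalyticAt ℝ h 0 ∧
      ∀ᶠ x in nhds 0, g x - f x = h x * f x ^ (r + 2)) :
    ∃ ε > (0 : ℝ), ∀ i : Fin (n + 1), ∀ L, lojS (fun p => ‖gradient f p.2‖)
      {p | |p.1| < 3 ∧ ‖p.2‖ < ε ∧ gradient f p.2 ≠ 0} L (r + 1) (XComp f g i) := by
  obtain ⟨h, hh, hk⟩ := hmem
  obtain ⟨C0, hC0⟩ := loj_main hf hf0
  have hga : ∀ x, AnalyticAt ℝ f x → AnalyticAt ℝ (gradient f) x := fun x hx =>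
    (ContinuousLinearMap.analyticAt ((InnerProductSpace.toDual ℝ (EuclideanSpace ℝ (Fin n))).symm.toContinuousLinearEquiv.toContinuousLinearMap) _).comp hx.fderiv
  have hsmall : ∀ c > (0 : ℝ), ∀ᶠ x in nhds (0 : EuclideanSpace ℝ (Fin n)), ‖gradient f x‖ < c := by
    intro c hc
    exact (hga 0 hf).continuousAt.norm.eventually_lt continuousAt_const (by simpa [hgrad] using hc)
  obtain ⟨ε0, hε0, hall⟩ := Metric.eventually_nhds_iff_ball.1
    (hf.eventually_analyticAt.and (hg.eventually_analyticAt.and (hh.eventually_analyticAt.and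
      (hC0.and ((hsmall 1 one_pos).and hk)))))
  set ρ : ℝ × EuclideanSpace ℝ (Fin n) → ℝ := fun p => ‖gradient f p.2‖ with hρdef
  set Ω : ℝ → Set (ℝ × EuclideanSpace ℝ (Fin n)) :=
    fun ε => {p | |p.1| < 3 ∧ ‖p.2‖ < ε ∧ gradient f p.2 ≠ 0} with hΩdef
  set ε1 := ε0 / 2 with hε1
  have hε1pos : 0 < ε1 := half_pos hε0
  have hin : ∀ x, x ∈ Metric.closedBall (0 : EuclideanSpace ℝ (Fin n)) ε1 → x ∈ Metric.ball (0 : EuclideanSpace ℝ (Fin n)) ε0 := by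
    intro x hx
    rw [Metric.mem_closedBall] at hx
    rw [Metric.mem_ball]; linarith
  have hinΩ : ∀ ε ≤ ε1, ∀ p ∈ Ω ε, p.2 ∈ Metric.ball (0 : EuclideanSpace ℝ (Fin n)) ε0 := by
    intro ε hε p hp
    apply hin
    rw [Metric.mem_closedBall, dist_zero_right]
    exact hp.2.1.le.trans hε
  have hopen : ∀ ε ≤ ε1, IsOpen (Ω ε) := by
    intro ε hε
    rw [isOpen_iff_mem_nhds]
    intro p hp
    have hfp := (hga _ (hall p.2 (hinΩ ε hε p hp)).1).continuousAt
    have hfp' : ContinuousAt (fun q : ℝ × EuclideanSpace ℝ (Fin n) => gradient f q.2) p :=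
      ContinuousAt.comp (g := gradient f) (f := Prod.snd) hfp continuousAt_snd
    have e1 : ∀ᶠ q in nhds p, |q.1| < 3 :=
      (continuous_fst.abs).continuousAt.eventually_lt continuousAt_const hp.1
    have e2 : ∀ᶠ q in nhds p, ‖q.2‖ < ε :=
      (continuous_snd.norm).continuousAt.eventually_lt continuousAt_const hp.2.1
    have e3 := hfp'.eventually_ne hp.2.2
    filter_upwards [e1, e2, e3] with q h1 h2 h3
    exact ⟨h1, h2, h3⟩
  have hρ : ∀ ε ≤ ε1, ∀ p ∈ Ω ε, 0 < ρ p ∧ ρ p ≤ 1 := fun ε hε p hp =>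
    ⟨norm_pos_iff.2 hp.2.2, (hall p.2 (hinΩ ε hε p hp)).2.2.2.2.1.le⟩
  have hΩ1 := hopen ε1 le_rfl
  have hρ1 := hρ ε1 le_rfl
  have hn1 : ∀ p ∈ Ω ε1, ‖p.2‖ ≤ ε1 := fun p hp => hp.2.1.le
  have hfan : AnalyticOnNhd ℝ f (Metric.closedBall 0 ε1) := fun x hx => (hall x (hin x hx)).1
  have hgan : AnalyticOnNhd ℝ g (Metric.closedBall 0 ε1) := fun x hx => (hall x (hin x hx)).2.1
  have hhan : AnalyticOnNhd ℝ h (Metric.closedBall 0 ε1) := fun x hx => (hall x (hin x hx)).2.2.1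
  -- the function f
  have hfS : ∀ L, lojS ρ (Ω ε1) L 1 (fun p => f p.2) := fun L =>
    lojS_analytic_one hΩ1 hρ1 ε1 hn1 f hfan C0 (fun p hp => (hall p.2 (hinΩ ε1 le_rfl p hp)).2.2.2.1) L
  -- partial derivatives of f
  have hfd : ∀ j : Fin n, ∀ L, lojS ρ (Ω ε1) L 1 (fun p => gradient f p.2 j) := by
    intro j L
    refine lojS_analytic_one hΩ1 hρ1 ε1 hn1 (fun x => gradient f x j) ?_ 1 ?_ L
    · have : (fun x => gradient f x j) = fun x => fderiv ℝ f x (EuclideanSpace.single j 1) := by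
        funext x; exact loj_grad_apply f x j
      rw [this]
      exact fun x hx => (ContinuousLinearMap.analyticAt
        (ContinuousLinearMap.apply ℝ ℝ (EuclideanSpace.single j (1 : ℝ))) _).comp (hfan.fderiv x hx)
    · intro p _
      rw [one_mul]
      simpa using PiLp.norm_apply_le (gradient f p.2) j
  -- the difference g - f
  have hkS : ∀ L, lojS ρ (Ω ε1) L (r + 2) (fun p => g p.2 - f p.2) := by
    intro L
    have h1 := lojS_mul hΩ1 hρ1 L _ _ _ _ (lojS_analytic hΩ1 hρ1 ε1 hn1 L h hhan)
      (lojS_pow hΩ1 hρ1 L _ (hfS L) (r + 2))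
    rw [show (0 : ℤ) + ((r + 2 : ℕ) : ℤ) = r + 2 by push_cast; ring] at h1
    exact lojS_congr hΩ1 L _ _ _ (fun p hp => ((hall p.2 (hinΩ ε1 le_rfl p hp)).2.2.2.2.2).symm) h1
  -- its partial derivatives
  have hkd : ∀ j : Fin n, ∀ L, lojS ρ (Ω ε1) L (r + 1)
      (fun p => gradient (fun y => g y - f y) p.2 j) := by
    intro j L
    have h1 := (hkS (L + 1)).2.2 (Fin.succ j)
    rw [show (r : ℤ) + 2 - 1 = r + 1 by ring] at h1
    refine lojS_congr hΩ1 L _ _ _ (fun p hp => ?_) h1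
    have hx := hall p.2 (hinΩ ε1 le_rfl p hp)
    rw [loj_pdP_snd (fun y => g y - f y) _ _ (hx.2.1.differentiableAt.sub hx.1.differentiableAt),
      loj_grad_apply]
    rfl
  obtain ⟨A, hA⟩ := lojS_bound (hkS 0)
  choose B hB using fun j => lojS_bound (hkd j 0)
  set M : ℝ := |A| + 3 * ∑ j, |B j| with hM
  have hM0 : 0 ≤ M := by positivity
  obtain ⟨ε', hε', hall'⟩ := Metric.eventually_nhds_iff_ball.1 (hsmall (1 / (2 * (M + 1))) (by positivity))
  set ε2 := min ε1 ε' with hε2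
  have hle : ε2 ≤ ε1 := min_le_left _ _
  have hΩ2 := hopen ε2 hle
  have hρ2 := hρ ε2 hle
  have hsub : Ω ε2 ⊆ Ω ε1 := fun p hp => ⟨hp.1, hp.2.1.trans_le hle, hp.2.2⟩
  have hMρ : ∀ p ∈ Ω ε2, M * ρ p ≤ 1 / 2 := by
    intro p hp
    have h1 : ρ p < 1 / (2 * (M + 1)) := hall' p.2 (by
      rw [Metric.mem_ball, dist_zero_right]; exact hp.2.1.trans_le (min_le_right _ _))
    rw [lt_div_iff₀ (by positivity)] at h1
    nlinarith [(hρ2 p hp).1]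
  have hkb : ∀ p ∈ Ω ε2, |g p.2 - f p.2| ≤ ρ p / 2 := by
    intro p hp
    have h1 := hA p (hsub hp)
    obtain ⟨h0, h01⟩ := hρ2 p hp
    have h2 : ρ p ^ ((r : ℤ) + 2) ≤ ρ p ^ (2 : ℤ) := zpow_le_zpow_right_of_le_one₀ h0 h01 (by omega)
    have h3 : A * ρ p ^ ((r : ℤ) + 2) ≤ M * ρ p ^ (2 : ℤ) :=
      mul_le_mul ((le_abs_self A).trans (by rw [hM]; linarith [show 0 ≤ ∑ j, |B j| by positivity])) h2
        (zpow_nonneg h0.le _) hM0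
    have h4 : ρ p ^ (2 : ℤ) = ρ p * ρ p := by rw [zpow_two]
    rw [h4] at h3
    have := hMρ p hp
    nlinarith
  have hgk : ∀ p ∈ Ω ε2, ‖p.1 • gradient (fun y => g y - f y) p.2‖ ≤ ρ p / 2 := by
    intro p hp
    obtain ⟨h0, h01⟩ := hρ2 p hp
    have h2 : ρ p ^ ((r : ℤ) + 1) ≤ ρ p ^ (2 : ℤ) := zpow_le_zpow_right_of_le_one₀ h0 h01 (by omega)
    have h1 : ‖gradient (fun y => g y - f y) p.2‖ ≤ (∑ j, |B j|) * ρ p ^ (2 : ℤ) := by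
      refine (loj_norm_le _).trans ?_
      rw [Finset.sum_mul]
      refine Finset.sum_le_sum fun j _ => (hB j p (hsub hp)).trans ?_
      exact mul_le_mul (le_abs_self _) h2 (zpow_nonneg h0.le _) (abs_nonneg _)
    rw [norm_smul, Real.norm_eq_abs]
    have h4 : ρ p ^ (2 : ℤ) = ρ p * ρ p := by rw [zpow_two]
    rw [h4] at h1
    have h5 : |p.1| * ‖gradient (fun y => g y - f y) p.2‖ ≤ 3 * ((∑ j, |B j|) * (ρ p * ρ p)) :=
      mul_le_mul hp.1.le h1 (norm_nonneg _) (by norm_num)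
    have h6 := hMρ p hp
    have h7 : 3 * (∑ j, |B j|) ≤ M := by rw [hM]; linarith [abs_nonneg A]
    have h8 : (3 * ∑ j, |B j|) * (ρ p * ρ p) ≤ M * (ρ p * ρ p) := by gcongr
    nlinarith
  set W : ℝ × EuclideanSpace ℝ (Fin n) → EuclideanSpace ℝ (Fin n) :=
    fun p => gradient f p.2 + p.1 • gradient (fun y => g y - f y) p.2 with hW
  have hWlow : ∀ p ∈ Ω ε2, ρ p / 2 ≤ ‖W p‖ := by
    intro p hp
    have h1 := norm_sub_le_norm_add (gradient f p.2) (p.1 • gradient (fun y => g y - f y) p.2)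
    have h2 := hgk p hp
    have h3 : ρ p = ‖gradient f p.2‖ := rfl
    have h4 : W p = gradient f p.2 + p.1 • gradient (fun y => g y - f y) p.2 := rfl
    rw [h4]
    linarith
  have hWS : ∀ j : Fin n, ∀ L, lojS ρ (Ω ε2) L 1 (fun p => W p j) := by
    intro j L
    have h1 := lojS_mul hΩ1 hρ1 L _ _ _ _ (lojS_fst hρ1 (fun p hp => hp.1.le) L) (hkd j L)
    have h2 := lojS_add hΩ1 L _ _ _ (hfd j L) (lojS_mono hρ1 L _ 1 _ (by omega) h1)
    exact lojS_subset hsub L _ _ h2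
  have hN : ∀ L, lojS ρ (Ω ε2) L 2 (fun p => ∑ j, W p j * W p j) := fun L =>
    lojS_sum hΩ2 hρ2 L 2 Finset.univ (fun j p => W p j * W p j)
      (fun j => lojS_mul hΩ2 hρ2 L 1 1 _ _ (hWS j L) (hWS j L)) (by norm_num)
  have hNeq : ∀ p, ∑ j, W p j * W p j = ‖W p‖ ^ 2 := by
    intro p
    rw [EuclideanSpace.real_norm_sq_eq]
    exact Finset.sum_congr rfl fun j _ => by ring
  have hNinv := lojS_inv hΩ2 hρ2 _ (1 / 4) (by norm_num) (fun p hp => by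
    rw [hNeq]
    have := hWlow p hp
    have := (hρ2 p hp).1
    nlinarith) hN
  have hgF : ∀ p ∈ Ω ε2, ‖gradF f g p.1 p.2‖ = ‖W p‖ := by
    intro p hp
    have : gradF f g p.1 p.2 = (g p.2 - f p.2, W p) := rfl
    rw [this, Prod.norm_mk]
    exact max_eq_right ((hkb p hp).trans (hWlow p hp))
  refine ⟨ε2, lt_min hε1pos hε', fun i L => ?_⟩
  have hkS2 := lojS_subset hsub L _ _ (hkS L)
  have hXF : ∀ p ∈ Ω ε2, XF f g p.1 p.2 =
      ((g p.2 - f p.2) * (∑ j, W p j * W p j)⁻¹) • (g p.2 - f p.2, W p) := by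
    intro p hp
    unfold XF
    rw [if_neg hp.2.2, hgF p hp, hNeq]
    rfl
  have hbase := lojS_mul hΩ2 hρ2 L _ _ _ _ hkS2 (hNinv L)
  refine Fin.cases ?_ (fun j => ?_) i
  · have h1 := lojS_mono hρ2 L _ (r + 1) _ (by omega) (lojS_mul hΩ2 hρ2 L _ _ _ _ hbase hkS2)
    refine lojS_congr hΩ2 L _ _ _ (fun p hp => ?_) h1
    show _ = (XF f g p.1 p.2).1
    rw [hXF p hp]; rfl
  · have h1 := lojS_mono hρ2 L _ (r + 1) _ (by omega) (lojS_mul hΩ2 hρ2 L _ _ _ _ hbase (hWS j L))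
    refine lojS_congr hΩ2 L _ _ _ (fun p hp => ?_) h1
    show _ = (XF f g p.1 p.2).2 j
    rw [hXF p hp]; rfl

/-- under the setup of the Main Theorem, for every multi-index `α` with
`|α| ≤ r`, after shrinking `U` there is `A'' > 0` such that
`|∂^α Xᵢ(ξ,x)| ≤ A''·dist(x,Z)^{r+1-|α|}` for `(ξ,x) ∈ G`, `x ∉ Z`. -/
theorem stmt9 {n : ℕ} (f g : EuclideanSpace ℝ (Fin n) → ℝ) (r : ℕ) (hr : 1 ≤ r)
    (hf : AnalyticAt ℝ f 0) (hg : AnalyticAt ℝ g 0) (hf0 : f 0 = 0) (hg0 : g 0 = 0)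
    (hgrad : gradient f 0 = 0)
    (hmem : ∃ h : EuclideanSpace ℝ (Fin n) → ℝ, AnalyticAt ℝ h 0 ∧
      ∀ᶠ x in nhds 0, g x - f x = h x * f x ^ (r + 2)) :
    ∃ δ > (2 : ℝ), ∀ α : Fin (n + 1) → ℕ, (∑ i, α i) ≤ r →
      ∃ U ∈ nhds (0 : EuclideanSpace ℝ (Fin n)), ∃ A'' > (0 : ℝ),
        ∀ x ∈ U, gradient f x ≠ 0 → ∀ ξ : ℝ, |ξ| < δ → ∀ i : Fin (n + 1),
          |mpdP α (XComp f g i) (ξ, x)| ≤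
            A'' * Metric.infDist x {y | gradient f y = 0} ^ (r + 1 - ∑ i, α i) := by
  obtain ⟨ε, hε, hX⟩ := loj_final f g r hr hf hg hf0 hgrad hmem
  obtain ⟨K, hK, hdist⟩ := loj_dist hf hgrad
  refine ⟨3, by norm_num, fun α hα => ?_⟩
  choose C hC using fun i => lojS_mpd α _ _ (hX i)
  refine ⟨_, Filter.inter_mem hdist (Metric.ball_mem_nhds 0 hε),
    (∑ i, |C i| + 1) * K ^ (r + 1 - ∑ i, α i), by positivity, ?_⟩
  rintro x ⟨hx1, hx2⟩ hx0 ξ hξ i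
  have hx2' : ‖x‖ < ε := by simpa using hx2
  have h1 := hC i (ξ, x) ⟨hξ, hx2', hx0⟩
  have h2 : (r : ℤ) + 1 - ((∑ i, α i : ℕ) : ℤ) = ((r + 1 - ∑ i, α i : ℕ) : ℤ) := by omega
  rw [h2, zpow_natCast] at h1
  refine h1.trans ?_
  rw [mul_assoc, ← mul_pow]
  have h3 : C i ≤ ∑ i, |C i| + 1 := by
    have := Finset.single_le_sum (f := fun i => |C i|) (fun i _ => abs_nonneg _) (Finset.mem_univ i)
    have h4 := le_abs_self (C i)
    linarith
  refine mul_le_mul h3 ?_ (by positivity) (by positivity)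
  exact pow_le_pow_left₀ (norm_nonneg _) hx1 _
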